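/- Let $R$ be a complete commutative noetherian local ring and $0 \to A \xrightarrow{f} B \xrightarrow{g} C \to 0$ an exact sequence of finitely generated Gorenstein projective $R$-modules with $f$ indecomposable and non-projective as an object of $\mathcal{H}$. Then for every $i \ge 0$, the morphism-category syzygy $\Omega^i_{\mathcal{H}}(f) = (\Omega^i A \to \Omega^i B \oplus Q)$ is a reduced $\mathcal{G}$-cover of $(\Omega^i A \xrightarrow{\Omega^i f} \Omega^i B)$, and $\mathbf{Cok}(\Omega^i_{\mathcal{H}}(f))$ is a reduced $\mathcal{E}$-envelope of $(\Omega^i B \xrightarrow{\Omega^i g} \Omega^i C)$. -/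

import Mathlib

open LinearMap Function

/-- A bundled module over a ring `S`. -/
structure Mdl (S : Type) [Ring S] : Type 1 where
  carrier : Type
  [ag : AddCommGroup carrier]
  [mod : Module S carrier]

attribute [instance] Mdl.ag Mdl.mod

instance {S : Type} [Ring S] : CoeSort (Mdl S) Type := ⟨Mdl.carrier⟩

/-- Bundle a module. -/
def Mdl.of (S : Type) [Ring S] (M : Type) [AddCommGroup M] [Module S M] : Mdl S := ⟨M⟩

section RingDefs

variable {S : Type} [Ring S]

/-- finitely generated projective -/
def FGProj (P : Mdl S) : Prop := Module.Projective S P.carrier ∧ Module.Finite S P.carrier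

/-- superfluous (small) submodule -/
def Superfluous {P : Type} [AddCommGroup P] [Module S P] (K : Submodule S P) : Prop :=
  ∀ N : Submodule S P, N ⊔ K = ⊤ → N = ⊤

/-- projective cover of a module -/
def IsProjCover {P M : Mdl S} (p : P.carrier →ₗ[S] M.carrier) : Prop :=
  FGProj P ∧ Function.Surjective p ∧ Superfluous (LinearMap.ker p)

/-- `N` is a (minimal) first syzygy of `M`. -/
def IsSyz1 (M N : Mdl S) : Prop :=
  ∃ (P : Mdl S) (p : P.carrier →ₗ[S] M.carrier),
    IsProjCover p ∧ Nonempty (N.carrier ≃ₗ[S] LinearMap.ker p)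

/-- `N` is an `n`-th (minimal) syzygy of `M`. -/
def IsSyz (n : ℕ) (M N : Mdl S) : Prop :=
  ∃ F : Fin (n + 1) → Mdl S,
    Nonempty ((F 0).carrier ≃ₗ[S] M.carrier) ∧
    Nonempty ((F (Fin.last n)).carrier ≃ₗ[S] N.carrier) ∧
    ∀ i : Fin n, IsSyz1 (F i.castSucc) (F i.succ)

/-- Gorenstein projective: a syzygy of a totally acyclic complex of
finitely generated projectives. -/
def IsGP (M : Mdl S) : Prop :=
  ∃ (P : ℤ → Mdl S) (d : ∀ i : ℤ, (P (i + 1)).carrier →ₗ[S] (P i).carrier),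
    (∀ i, FGProj (P i)) ∧
    (∀ i, LinearMap.range (d (i + 1)) = LinearMap.ker (d i)) ∧
    (∀ (Q : Mdl S), Module.Projective S Q.carrier →
      ∀ (i : ℤ) (g : (P (i + 1)).carrier →ₗ[S] Q.carrier), g ∘ₗ d (i + 1) = 0 →
        ∃ h : (P i).carrier →ₗ[S] Q.carrier, h ∘ₗ d i = g) ∧
    Nonempty (M.carrier ≃ₗ[S] LinearMap.ker (d 0))

/-- a map factoring through a projective module -/
def FactorsThruProj {A B : Mdl S} (φ : A.carrier →ₗ[S] B.carrier) : Prop :=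
  ∃ (Q : Mdl S) (α : A.carrier →ₗ[S] Q.carrier) (β : Q.carrier →ₗ[S] B.carrier),
    Module.Projective S Q.carrier ∧ β ∘ₗ α = φ

/-- `M` is stable: it has no nonzero projective direct summand. -/
def NoProjSummand (M : Mdl S) : Prop :=
  ∀ N Q : Mdl S, Nonempty (M.carrier ≃ₗ[S] (N.carrier × Q.carrier)) →
    Module.Projective S Q.carrier → Subsingleton Q.carrier

/-- indecomposable module -/
def IndecMod (M : Mdl S) : Prop :=
  Nontrivial M.carrier ∧
  ∀ N Q : Mdl S, Nonempty (M.carrier ≃ₗ[S] (N.carrier × Q.carrier)) →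
    Subsingleton N.carrier ∨ Subsingleton Q.carrier

end RingDefs
section MorCat

variable {R : Type} [CommRing R]

/-- An object of the morphism category `𝓜`. -/
structure MObj (R : Type) [CommRing R] : Type 1 where
  dom : Mdl R
  cod : Mdl R
  map : dom.carrier →ₗ[R] cod.carrier

/-- A morphism in the morphism category: a commutative square. -/
structure MHom (f g : MObj R) : Type where
  h1 : f.dom.carrier →ₗ[R] g.dom.carrier
  h2 : f.cod.carrier →ₗ[R] g.cod.carrier
  comm : g.map ∘ₗ h1 = h2 ∘ₗ f.map

/-- isomorphism in the morphism category -/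
def MIso (f g : MObj R) : Prop :=
  ∃ (e1 : f.dom.carrier ≃ₗ[R] g.dom.carrier) (e2 : f.cod.carrier ≃ₗ[R] g.cod.carrier),
    g.map ∘ₗ (e1 : f.dom.carrier →ₗ[R] g.dom.carrier)
      = (e2 : f.cod.carrier →ₗ[R] g.cod.carrier) ∘ₗ f.map

/-- epimorphism in the morphism category (componentwise surjective) -/
def MEpi {f g : MObj R} (φ : MHom f g) : Prop :=
  Function.Surjective φ.h1 ∧ Function.Surjective φ.h2

/-- projective object of the morphism category -/
def MProj (f : MObj R) : Prop :=
  ∀ (g h : MObj R) (e : MHom g h), MEpi e → ∀ φ : MHom f h,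
    ∃ ψ : MHom f g, e.h1 ∘ₗ ψ.h1 = φ.h1 ∧ e.h2 ∘ₗ ψ.h2 = φ.h2

/-- projective cover in the morphism category: a right minimal epimorphism
from a projective object -/
def MProjCover {q f : MObj R} (φ : MHom q f) : Prop :=
  MProj q ∧ MEpi φ ∧
  ∀ ξ : MHom q q, φ.h1 ∘ₗ ξ.h1 = φ.h1 → φ.h2 ∘ₗ ξ.h2 = φ.h2 →
    Function.Bijective ξ.h1 ∧ Function.Bijective ξ.h2

/-- `g` is a first syzygy of `f` in the morphism category. -/
def MSyz1 (f g : MObj R) : Prop :=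
  ∃ (q : MObj R) (φ : MHom q f), MProjCover φ ∧
    ∃ k : (LinearMap.ker φ.h1 : Type) →ₗ[R] (LinearMap.ker φ.h2 : Type),
      (LinearMap.ker φ.h2).subtype ∘ₗ k = q.map ∘ₗ (LinearMap.ker φ.h1).subtype ∧
      MIso g ⟨Mdl.of R (LinearMap.ker φ.h1), Mdl.of R (LinearMap.ker φ.h2), k⟩

/-- `g` is an `n`-th syzygy of `f` in the morphism category. -/
def MSyz (n : ℕ) (f g : MObj R) : Prop :=
  ∃ F : Fin (n + 1) → MObj R,
    MIso (F 0) f ∧ MIso (F (Fin.last n)) g ∧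
    ∀ i : Fin n, MSyz1 (F i.castSucc) (F i.succ)

/-- `g` is the induced map on (minimal) first syzygies of the map `f`. -/
def MapSyz1 (f g : MObj R) : Prop :=
  ∃ (PA PB : Mdl R) (pA : PA.carrier →ₗ[R] f.dom.carrier)
    (pB : PB.carrier →ₗ[R] f.cod.carrier) (L : PA.carrier →ₗ[R] PB.carrier),
    IsProjCover pA ∧ IsProjCover pB ∧ f.map ∘ₗ pA = pB ∘ₗ L ∧
    ∃ k : (LinearMap.ker pA : Type) →ₗ[R] (LinearMap.ker pB : Type),
      (LinearMap.ker pB).subtype ∘ₗ k = L ∘ₗ (LinearMap.ker pA).subtype ∧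
      MIso g ⟨Mdl.of R (LinearMap.ker pA), Mdl.of R (LinearMap.ker pB), k⟩

/-- `g` is the induced map on minimal `n`-th syzygies of the map `f`. -/
def MapSyz (n : ℕ) (f g : MObj R) : Prop :=
  ∃ F : Fin (n + 1) → MObj R,
    MIso (F 0) f ∧ MIso (F (Fin.last n)) g ∧
    ∀ i : Fin n, MapSyz1 (F i.castSucc) (F i.succ)

/-- direct sum in the morphism category -/
def DSum (f g : MObj R) : MObj R :=
  ⟨Mdl.of R (f.dom.carrier × g.dom.carrier), Mdl.of R (f.cod.carrier × g.cod.carrier),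
    f.map.prodMap g.map⟩

/-- the zero object, up to iso -/
def MTrivial (f : MObj R) : Prop := Subsingleton f.dom.carrier ∧ Subsingleton f.cod.carrier

/-- indecomposable object of the morphism category -/
def MIndec (f : MObj R) : Prop :=
  ¬ MTrivial f ∧ ∀ g h : MObj R, MIso f (DSum g h) → MTrivial g ∨ MTrivial h

/-- the endomorphism ring of `f` in the morphism category is local -/
def MEndLocal (f : MObj R) : Prop :=
  ¬ MTrivial f ∧
  ∀ ξ : MHom f f,
    (Function.Bijective ξ.h1 ∧ Function.Bijective ξ.h2) ∨
    (Function.Bijective ((LinearMap.id : f.dom.carrier →ₗ[R] f.dom.carrier) - ξ.h1) ∧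
     Function.Bijective ((LinearMap.id : f.cod.carrier →ₗ[R] f.cod.carrier) - ξ.h2))

/-- no nonzero projective direct summand in the morphism category -/
def MNoProjSummand (f : MObj R) : Prop :=
  ∀ g q : MObj R, MIso f (DSum g q) → MProj q → MTrivial q

/-- the cokernel module of an object -/
def CokMod (f : MObj R) : Mdl R := Mdl.of R (f.cod.carrier ⧸ LinearMap.range f.map)

/-- the cokernel object `Cok(f) : B → Cok f` -/
def CokObj (f : MObj R) : MObj R := ⟨f.cod, CokMod f, (LinearMap.range f.map).mkQ⟩

/-- Gorenstein projective objects of the morphism category -/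
def InG (f : MObj R) : Prop :=
  Function.Injective f.map ∧ IsGP f.dom ∧ IsGP (CokMod f)

/-- objects of `𝓗`: morphisms between Gorenstein projective modules -/
def InH (f : MObj R) : Prop := IsGP f.dom ∧ IsGP f.cod

/-- objects of `𝓔`: epimorphisms between Gorenstein projective modules -/
def InE (f : MObj R) : Prop := InH f ∧ Function.Surjective f.map

/-- `𝓖`-precover -/
def IsGPrecover {g x : MObj R} (φ : MHom g x) : Prop :=
  InG g ∧ ∀ g' : MObj R, InG g' → ∀ ψ : MHom g' x,
    ∃ ξ : MHom g' g, φ.h1 ∘ₗ ξ.h1 = ψ.h1 ∧ φ.h2 ∘ₗ ξ.h2 = ψ.h2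

/-- right minimal morphism -/
def MRightMin {g x : MObj R} (φ : MHom g x) : Prop :=
  ∀ ξ : MHom g g, φ.h1 ∘ₗ ξ.h1 = φ.h1 → φ.h2 ∘ₗ ξ.h2 = φ.h2 →
    Function.Bijective ξ.h1 ∧ Function.Bijective ξ.h2

/-- `𝓖`-cover -/
def IsGCover {g x : MObj R} (φ : MHom g x) : Prop := IsGPrecover φ ∧ MRightMin φ

/-- `𝓔`-preenvelope -/
def IsEPreenvelope {x e : MObj R} (φ : MHom x e) : Prop :=
  InE e ∧ ∀ e' : MObj R, InE e' → ∀ ψ : MHom x e',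
    ∃ ξ : MHom e e', ξ.h1 ∘ₗ φ.h1 = ψ.h1 ∧ ξ.h2 ∘ₗ φ.h2 = ψ.h2

/-- left minimal morphism -/
def MLeftMin {x e : MObj R} (φ : MHom x e) : Prop :=
  ∀ ξ : MHom e e, ξ.h1 ∘ₗ φ.h1 = φ.h1 → ξ.h2 ∘ₗ φ.h2 = φ.h2 →
    Function.Bijective ξ.h1 ∧ Function.Bijective ξ.h2

/-- `𝓔`-envelope -/
def IsEEnvelope {x e : MObj R} (φ : MHom x e) : Prop := IsEPreenvelope φ ∧ MLeftMin φ

/-- injective objects of `𝓗`: sums of `(P → P)` and `(P → 0)`,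
i.e. objects isomorphic to a projection `P × P' → P`. -/
def HInj (q : MObj R) : Prop :=
  ∃ P P' : Mdl R, FGProj P ∧ FGProj P' ∧
    MIso q ⟨Mdl.of R (P.carrier × P'.carrier), P, LinearMap.fst R P.carrier P'.carrier⟩

/-- no nonzero `𝓗`-injective direct summand -/
def MNoHInjSummand (f : MObj R) : Prop :=
  ∀ g q : MObj R, MIso f (DSum g q) → HInj q → MTrivial q

/-- `s` is (isomorphic to) the reduced `𝓖`-cover of `x` -/
def IsRedGCover (s x : MObj R) : Prop :=
  ∃ (g : MObj R) (φ : MHom g x), IsGCover φ ∧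
    ∃ q : MObj R, MProj q ∧ MIso g (DSum s q) ∧ MNoProjSummand s

/-- `s` is (isomorphic to) the reduced `𝓔`-envelope of `x` -/
def IsRedEEnvelope (s x : MObj R) : Prop :=
  ∃ (e : MObj R) (φ : MHom x e), IsEEnvelope φ ∧
    ∃ q : MObj R, HInj q ∧ MIso e (DSum s q) ∧ MNoHInjSummand s

/-- Auslander transpose of a module -/
def IsTranspose (M T : Mdl R) : Prop :=
  ∃ (P1 P0 : Mdl R) (d : P1.carrier →ₗ[R] P0.carrier) (p : P0.carrier →ₗ[R] M.carrier),
    FGProj P1 ∧ FGProj P0 ∧ Function.Surjective p ∧ Superfluous (LinearMap.ker p) ∧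
    LinearMap.range d = LinearMap.ker p ∧ Superfluous (LinearMap.ker d) ∧
    Nonempty (T.carrier ≃ₗ[R] (Module.Dual R P1.carrier ⧸ LinearMap.range d.dualMap))

/-- `L` is `λ M = Ω¹ Tr M`. -/
def LambdaOf (M L : Mdl R) : Prop := ∃ T : Mdl R, IsTranspose M T ∧ IsSyz1 T L

/-- horizontally linked module -/
def HorLinkedMod (M : Mdl R) : Prop :=
  ∃ L L2 : Mdl R, LambdaOf M L ∧ LambdaOf L L2 ∧ Nonempty (M.carrier ≃ₗ[R] L2.carrier)

/-- the Auslander transpose in the morphism category, computed by dualizing a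
(componentwise) minimal projective presentation
`(P₁ → P₁ ⊕ Q₁) → (P₀ → P₀ ⊕ Q₀) → f → 0` in `𝓜` against `𝐫 = (R → R ⊕ R)`. -/
def IsMTranspose (f t : MObj R) : Prop :=
  ∃ (P1 Q1 P0 Q0 : Mdl R)
    (u : P1.carrier →ₗ[R] P0.carrier)
    (v : (P1.carrier × Q1.carrier) →ₗ[R] (P0.carrier × Q0.carrier))
    (p : P0.carrier →ₗ[R] f.dom.carrier)
    (q : (P0.carrier × Q0.carrier) →ₗ[R] f.cod.carrier),
    FGProj P1 ∧ FGProj Q1 ∧ FGProj P0 ∧ FGProj Q0 ∧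
    v ∘ₗ LinearMap.inl R P1.carrier Q1.carrier = LinearMap.inl R P0.carrier Q0.carrier ∘ₗ u ∧
    q ∘ₗ LinearMap.inl R P0.carrier Q0.carrier = f.map ∘ₗ p ∧
    Function.Surjective p ∧ Function.Surjective q ∧
    Superfluous (LinearMap.ker p) ∧ Superfluous (LinearMap.ker q) ∧
    LinearMap.range u = LinearMap.ker p ∧ LinearMap.range v = LinearMap.ker q ∧
    Superfluous (LinearMap.ker u) ∧ Superfluous (LinearMap.ker v) ∧
    ∃ (e1 : t.dom.carrier ≃ₗ[R]
        (Module.Dual R Q1.carrier ⧸ LinearMap.range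
          (LinearMap.snd R P0.carrier Q0.carrier ∘ₗ v ∘ₗ
            LinearMap.inr R P1.carrier Q1.carrier).dualMap))
      (e2 : t.cod.carrier ≃ₗ[R]
        (Module.Dual R (P1.carrier × Q1.carrier) ⧸ LinearMap.range v.dualMap))
      (tt : (Module.Dual R Q1.carrier ⧸ LinearMap.range
          (LinearMap.snd R P0.carrier Q0.carrier ∘ₗ v ∘ₗ
            LinearMap.inr R P1.carrier Q1.carrier).dualMap) →ₗ[R]
        (Module.Dual R (P1.carrier × Q1.carrier) ⧸ LinearMap.range v.dualMap)),
      tt ∘ₗ (LinearMap.range (LinearMap.snd R P0.carrier Q0.carrier ∘ₗ v ∘ₗ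
          LinearMap.inr R P1.carrier Q1.carrier).dualMap).mkQ
        = (LinearMap.range v.dualMap).mkQ ∘ₗ (LinearMap.snd R P1.carrier Q1.carrier).dualMap ∧
      (e2 : t.cod.carrier →ₗ[R] _) ∘ₗ t.map = tt ∘ₗ (e1 : t.dom.carrier →ₗ[R] _)

/-- `g ≅ λ_𝓜 f = Ω¹_𝓜 Tr_𝓜 f` -/
def MLambda (f g : MObj R) : Prop := ∃ t : MObj R, IsMTranspose f t ∧ MSyz1 t g

/-- horizontally linked object of the submodule category -/
def MHorLinked (f : MObj R) : Prop :=
  ∃ g h : MObj R, MLambda f g ∧ MLambda g h ∧ MIso f h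

/-- the dual object `(B' → A')` of `(A → B)` -/
def DualObj (f : MObj R) : MObj R :=
  ⟨Mdl.of R (Module.Dual R f.cod.carrier), Mdl.of R (Module.Dual R f.dom.carrier), f.map.dualMap⟩

/-- componentwise short exact sequence in the morphism category -/
def MShortExact {a b c : MObj R} (φ : MHom a b) (ψ : MHom b c) : Prop :=
  Function.Injective φ.h1 ∧ Function.Injective φ.h2 ∧
  Function.Surjective ψ.h1 ∧ Function.Surjective ψ.h2 ∧
  LinearMap.range φ.h1 = LinearMap.ker ψ.h1 ∧
  LinearMap.range φ.h2 = LinearMap.ker ψ.h2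

/-- split monomorphism -/
def MSplitMono {a b : MObj R} (φ : MHom a b) : Prop :=
  ∃ σ : MHom b a, σ.h1 ∘ₗ φ.h1 = LinearMap.id ∧ σ.h2 ∘ₗ φ.h2 = LinearMap.id

/-- split epimorphism -/
def MSplitEpi {x c : MObj R} (θ : MHom x c) : Prop :=
  ∃ σ : MHom c x, θ.h1 ∘ₗ σ.h1 = LinearMap.id ∧ θ.h2 ∘ₗ σ.h2 = LinearMap.id

/-- almost split sequence in a full subcategory `C` of the morphism category -/
def IsAlmostSplitIn (C : MObj R → Prop) {a b c : MObj R}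
    (φ : MHom a b) (ψ : MHom b c) : Prop :=
  C a ∧ C b ∧ C c ∧ MShortExact φ ψ ∧ ¬ MSplitMono φ ∧ MEndLocal a ∧
  ∀ x : MObj R, C x → ∀ θ : MHom x c, ¬ MSplitEpi θ →
    ∃ ρ : MHom x b, ψ.h1 ∘ₗ ρ.h1 = θ.h1 ∧ ψ.h2 ∘ₗ ρ.h2 = θ.h2

end MorCat

/-- A Gorenstein local ring: noetherian local, and some fixed syzygy functor lands in
Gorenstein projective (maximal Cohen-Macaulay) modules. -/
def IsGorensteinLocal (R : Type) [CommRing R] : Prop :=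
  IsNoetherianRing R ∧ IsLocalRing R ∧
  ∃ n : ℕ, ∀ M : Mdl R, Module.Finite R M.carrier → ∀ N : Mdl R, IsSyz n M N → IsGP N

section GorensteinProjective

theorem exists_int_chain {α : Type*} (r : α → α → Prop) (p : α → Prop)
    (hl : ∀ a, p a → ∃ b, p b ∧ r b a) (hr : ∀ a, p a → ∃ b, p b ∧ r a b)
    (k : ℤ) {m : α} (hm : p m) :
    ∃ Z : ℤ → α, Z k = m ∧ ∀ i, p (Z i) ∧ r (Z (i + 1)) (Z i) := by
  choose L hLp hL using hl
  choose U hUp hU using hr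
  let l : {a // p a} → {a // p a} := fun a => ⟨L a.1 a.2, hLp a.1 a.2⟩
  let u : {a // p a} → {a // p a} := fun a => ⟨U a.1 a.2, hUp a.1 a.2⟩
  let Z : ℤ → {a // p a} := fun i =>
    Int.casesOn i (fun n => l^[n] ⟨m, hm⟩) (fun n => u^[n + 1] ⟨m, hm⟩)
  have hZ : ∀ i : ℤ, r (Z (i + 1)).1 (Z i).1 := by
    intro i
    rcases i with n | n
    · have h1 : Z (Int.ofNat n + 1) = l (Z (Int.ofNat n)) :=
        Function.iterate_succ_apply' l n ⟨m, hm⟩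
      rw [h1]
      exact hL _ _
    · have h1 : Z (Int.negSucc n) = u (Z (Int.negSucc n + 1)) := by
        rcases n with _ | n
        · rfl
        · exact Function.iterate_succ_apply' u (n + 1) ⟨m, hm⟩
      rw [h1]
      exact hU _ _
  refine ⟨fun i => (Z (i - k)).1, ?_, fun i => ⟨(Z (i - k)).2, ?_⟩⟩
  · simp only [sub_self]
    rfl
  · have h := hZ (i - k)
    rwa [show i - k + 1 = i + 1 - k by ring] at h

variable {R : Type} [CommRing R]

theorem exists_comp_eq_of_ker_le {X Y Z : Type*} [AddCommGroup X] [AddCommGroup Y]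
    [AddCommGroup Z] [Module R X] [Module R Y] [Module R Z] {f : X →ₗ[R] Y}
    (hf : Surjective f) (g : X →ₗ[R] Z) (h : ker f ≤ ker g) : ∃ t : Y →ₗ[R] Z, t ∘ₗ f = g := by
  refine ⟨(ker f).liftQ g h ∘ₗ (f.quotKerEquivOfSurjective hf).symm.toLinearMap, ?_⟩
  ext x
  have : (f.quotKerEquivOfSurjective hf).symm (f x) = (ker f).mkQ x := by
    rw [LinearEquiv.symm_apply_eq]
    rfl
  simp [this]

theorem exists_comp_eq_of_exact {N E X Y : Type*} [AddCommGroup N] [AddCommGroup E]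
    [AddCommGroup X] [AddCommGroup Y] [Module R N] [Module R E] [Module R X] [Module R Y]
    {j : N →ₗ[R] E} {π : E →ₗ[R] X} (hj : Injective j) (h : Exact j π) (f : Y →ₗ[R] E)
    (hf : ∀ y, π (f y) = 0) : ∃ t : Y →ₗ[R] N, j ∘ₗ t = f := by
  refine ⟨(LinearEquiv.ofInjective j hj).symm.toLinearMap ∘ₗ
    f.codRestrict (range j) (fun y => (h (f y)).1 (hf y)), ?_⟩
  ext y
  exact congrArg Subtype.val ((LinearEquiv.ofInjective j hj).apply_symm_apply
    ⟨f y, (h (f y)).1 (hf y)⟩)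

/-- `Ext¹(X, Q) = 0` for every projective `Q`, phrased as extension of maps. -/
def ExtVanishes (X : Mdl R) : Prop :=
  ∀ (N E : Mdl R) (j : N →ₗ[R] E) (π : E →ₗ[R] X), Injective j → Surjective π → Exact j π →
    ∀ Q : Mdl R, Module.Projective R Q → ∀ u : N →ₗ[R] Q, ∃ h : E →ₗ[R] Q, h ∘ₗ j = u

/-- `N` is the kernel of a surjection from a finitely generated projective module onto `X`. -/
def SyzygyOf (N X : Mdl R) : Prop :=
  ∃ (P : Mdl R) (j : N →ₗ[R] P) (π : P →ₗ[R] X),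
    FGProj P ∧ Injective j ∧ Surjective π ∧ Exact j π

theorem ExtVanishes.of_presentation {N P X : Mdl R} [Module.Projective R P] {j : N →ₗ[R] P}
    {π : P →ₗ[R] X} (hπ : Surjective π) (hex : Exact j π)
    (H : ∀ Q : Mdl R, Module.Projective R Q → ∀ u : N →ₗ[R] Q, ∃ h : P →ₗ[R] Q, h ∘ₗ j = u) :
    ExtVanishes X := by
  intro N' E j' π' hj' hπ' hex' Q hQ u
  obtain ⟨l, hl⟩ := Module.projective_lifting_property π' π hπ'
  have hl' : ∀ p, π' (l p) = π p := fun p => LinearMap.congr_fun hl p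
  obtain ⟨t, ht⟩ := exists_comp_eq_of_exact hj' hex' (l ∘ₗ j) (fun n => by
    simp [hl', hex.apply_apply_eq_zero])
  have ht' : ∀ n, j' (t n) = l (j n) := fun n => LinearMap.congr_fun ht n
  obtain ⟨h0, hh0⟩ := H Q hQ (u ∘ₗ t)
  have hh0' : ∀ n, h0 (j n) = u (t n) := fun n => LinearMap.congr_fun hh0 n
  obtain ⟨h, hh⟩ := exists_comp_eq_of_ker_le (f := l.coprod j') (by
    intro e
    obtain ⟨p, hp⟩ := hπ (π' e)
    obtain ⟨n, hn⟩ := (hex' (e - l p)).1 (by simp [hl', hp])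
    exact ⟨(p, n), by simp [hn]⟩) (h0.coprod u) (by
    rintro ⟨p, n⟩ hpn
    simp only [mem_ker, coprod_apply] at hpn ⊢
    have hp : π p = 0 := by
      have := congrArg π' hpn
      simpa [hl', hex'.apply_apply_eq_zero] using this
    obtain ⟨n0, rfl⟩ := (hex p).1 hp
    rw [← ht', ← map_add] at hpn
    rw [hh0', ← map_add, hj' (hpn.trans (map_zero j').symm), map_zero])
  refine ⟨h, LinearMap.ext fun n => ?_⟩
  have := LinearMap.congr_fun hh (0, n)
  simpa using this

theorem ExtVanishes.of_equiv_prod {X X' P P' : Mdl R} (hX : ExtVanishes X)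
    (hP' : FGProj P') (e : (X' × P) ≃ₗ[R] (X × P')) (N' : Mdl R) (hN : SyzygyOf N' X) :
    ExtVanishes X' := by
  obtain ⟨F, j, π, hF, hj, hπ, hex⟩ := hN
  have : Module.Projective R F := hF.1
  have : Module.Projective R P' := hP'.1
  have hprod : ExtVanishes (⟨X × P'⟩ : Mdl R) := by
    refine ExtVanishes.of_presentation (N := N') (P := ⟨F × P'⟩) (j := inl R F P' ∘ₗ j)
      (π := π.prodMap LinearMap.id) (hπ.prodMap surjective_id) ?_ ?_
    · rintro ⟨a, b⟩
      constructor
      · intro h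
        have h1 : π a = 0 := congrArg Prod.fst h
        have h2 : b = 0 := congrArg Prod.snd h
        obtain ⟨n, rfl⟩ := (hex a).1 h1
        exact ⟨n, by simp [h2]⟩
      · rintro ⟨n, hn⟩
        obtain ⟨rfl, rfl⟩ : j n = a ∧ 0 = b := by simpa using hn
        simp [hex.apply_apply_eq_zero]
    · intro Q hQ u
      obtain ⟨h, hh⟩ := hX N' F j π hj hπ hex Q hQ u
      exact ⟨h ∘ₗ fst R F P', by rw [← hh]; ext; simp⟩
  intro N E j' π' hj' hπ' hex' Q hQ u
  obtain ⟨h, hh⟩ := hprod N ⟨E × P⟩ (inl R E P ∘ₗ j')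
    (e.toLinearMap ∘ₗ π'.prodMap LinearMap.id) (inl_injective.comp hj')
    (e.surjective.comp (hπ'.prodMap surjective_id)) (by
      rintro ⟨a, b⟩
      constructor
      · intro h
        have h0 : (π' a, b) = 0 := e.map_eq_zero_iff.1 h
        obtain ⟨n, rfl⟩ := (hex' a).1 (congrArg Prod.fst h0)
        have h2 : b = 0 := congrArg Prod.snd h0
        exact ⟨n, by simp [h2]⟩
      · rintro ⟨n, hn⟩
        obtain ⟨rfl, rfl⟩ : j' n = a ∧ 0 = b := by simpa using hn
        simp [hex'.apply_apply_eq_zero]) Q hQ u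
  exact ⟨h ∘ₗ inl R E P, hh⟩

theorem FGProj.prod {P Q : Mdl R} (hP : FGProj P) (hQ : FGProj Q) :
    FGProj (⟨P × Q⟩ : Mdl R) := by
  obtain ⟨_, _⟩ := hP
  obtain ⟨_, _⟩ := hQ
  exact ⟨inferInstanceAs (Module.Projective R (P × Q)), inferInstanceAs (Module.Finite R (P × Q))⟩

theorem SyzygyOf.of_ker {P X : Mdl R} (hP : FGProj P) (π : P →ₗ[R] X) (hπ : Surjective π) :
    SyzygyOf ⟨ker π⟩ X :=
  ⟨P, (ker π).subtype, π, hP, Subtype.val_injective, hπ, fun x => by simp⟩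

theorem SyzygyOf.prod {N X P : Mdl R} (h : SyzygyOf N X) (hP : FGProj P) :
    SyzygyOf N ⟨X × P⟩ := by
  obtain ⟨F, j, π, hF, hj, hπ, hex⟩ := h
  refine ⟨⟨F × P⟩, inl R F P ∘ₗ j, π.prodMap LinearMap.id, hF.prod hP, inl_injective.comp hj,
    hπ.prodMap surjective_id, ?_⟩
  rintro ⟨a, b⟩
  constructor
  · intro h
    have h1 : π a = 0 := congrArg Prod.fst h
    have h2 : b = 0 := congrArg Prod.snd h
    obtain ⟨n, rfl⟩ := (hex a).1 h1
    exact ⟨n, by simp [h2]⟩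
  · rintro ⟨n, hn⟩
    obtain ⟨rfl, rfl⟩ : j n = a ∧ 0 = b := by simpa using hn
    simp [hex.apply_apply_eq_zero]

theorem SyzygyOf.congr {N X N' X' : Mdl R} (h : SyzygyOf N X) (e : N ≃ₗ[R] N')
    (e' : X ≃ₗ[R] X') : SyzygyOf N' X' := by
  obtain ⟨F, j, π, hF, hj, hπ, hex⟩ := h
  refine ⟨F, j ∘ₗ e.symm.toLinearMap, e'.toLinearMap ∘ₗ π, hF, hj.comp e.symm.injective,
    e'.surjective.comp hπ, fun x => ?_⟩
  have : (e' (π x) = 0 ↔ π x = 0) := e'.map_eq_zero_iff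
  simp only [coe_comp, LinearEquiv.coe_coe, comp_apply, this, hex x, Set.mem_range]
  exact e.symm.surjective.exists

/-- Schanuel's lemma. -/
theorem SyzygyOf.schanuel {N N' X : Mdl R} (h : SyzygyOf N X) (h' : SyzygyOf N' X) :
    ∃ F G : Mdl R, FGProj F ∧ FGProj G ∧ Nonempty ((N × G) ≃ₗ[R] (N' × F)) := by
  obtain ⟨F, j, f, hF, hj, hf, hex⟩ := h
  obtain ⟨G, j', g, hG, hj', hg, hex'⟩ := h'
  refine ⟨F, G, hF, hG, ?_⟩
  obtain ⟨_, _⟩ := hF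
  obtain ⟨_, _⟩ := hG
  obtain ⟨u, hu⟩ := Module.projective_lifting_property g f hg
  obtain ⟨v, hv⟩ := Module.projective_lifting_property f g hf
  have hu' : ∀ p, g (u p) = f p := fun p => LinearMap.congr_fun hu p
  have hv' : ∀ p, f (v p) = g p := fun p => LinearMap.congr_fun hv p
  have hfj : ∀ n, f (j n) = 0 := fun n => hex.apply_apply_eq_zero n
  have hgj : ∀ n, g (j' n) = 0 := fun n => hex'.apply_apply_eq_zero n
  obtain ⟨s, hs⟩ := exists_comp_eq_of_exact hj' hex'
    (snd R N G - u ∘ₗ (j.coprod v)) (by rintro ⟨x, y⟩; simp [hu', hv', hfj])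
  obtain ⟨t, ht⟩ := exists_comp_eq_of_exact hj hex
    (snd R N' F - v ∘ₗ (j'.coprod u)) (by rintro ⟨x, y⟩; simp [hu', hv', hgj])
  have hs' : ∀ x, j' (s x) = x.2 - u (j x.1 + v x.2) := fun x => by
    simpa using LinearMap.congr_fun hs x
  have ht' : ∀ x, j (t x) = x.2 - v (j' x.1 + u x.2) := fun x => by
    simpa using LinearMap.congr_fun ht x
  refine ⟨LinearEquiv.ofLinearMap (s.prod (j.coprod v)) (t.prod (j'.coprod u)) ?_ ?_⟩
  · refine LinearMap.ext fun x => Prod.ext (hj' ?_) ?_ <;> simp [hs', ht']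
  · refine LinearMap.ext fun x => Prod.ext (hj ?_) ?_ <;> simp [hs', ht']

theorem IsGP.of_class [IsNoetherianRing R] (p : Mdl R → Prop)
    (hext : ∀ X, p X → ExtVanishes X)
    (hl : ∀ X, p X → ∃ N, p N ∧ SyzygyOf N X)
    (hr : ∀ X, p X → ∃ Y, p Y ∧ SyzygyOf X Y) {M : Mdl R} (hM : p M) : IsGP M := by
  obtain ⟨Z, hZ0, hZ⟩ := exists_int_chain SyzygyOf p hl hr (0 + 1 + 1) hM
  choose hp P j π hP hj hπ hex using hZ
  refine ⟨P, fun i => j i ∘ₗ π (i + 1), hP, fun i => ?_, fun Q hQ i g hg => ?_, ?_⟩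
  · rw [range_comp_of_range_eq_top _ (range_eq_top.2 (hπ _)),
      ker_comp_of_ker_eq_bot _ (ker_eq_bot.2 (hj _))]
    exact (LinearMap.exact_iff.1 (hex (i + 1))).symm
  · obtain ⟨t, ht⟩ := exists_comp_eq_of_ker_le (hπ (i + 1)) g (by
      intro x hx
      obtain ⟨y, rfl⟩ := (hex (i + 1) x).1 hx
      obtain ⟨w, rfl⟩ := hπ (i + 1 + 1) y
      exact LinearMap.congr_fun hg w)
    obtain ⟨h, hh⟩ := hext _ (hp i) _ _ (j i) (π i) (hj i) (hπ i) (hex i) Q hQ t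
    exact ⟨h, by rw [← LinearMap.comp_assoc, hh, ht]⟩
  · have e1 : ker (j 0 ∘ₗ π (0 + 1)) = range (j (0 + 1)) := by
      rw [ker_comp_of_ker_eq_bot _ (ker_eq_bot.2 (hj _))]
      exact LinearMap.exact_iff.1 (hex (0 + 1))
    rw [← hZ0]
    exact ⟨(LinearEquiv.ofInjective _ (hj (0 + 1))).trans (LinearEquiv.ofEq _ _ e1.symm)⟩

/-- Closure of a class of modules under first syzygies. -/
inductive SyzygyClosure (p : Mdl R → Prop) : Mdl R → Prop
  | base {X : Mdl R} : p X → SyzygyClosure p X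
  | syz {N X : Mdl R} : SyzygyClosure p X → SyzygyOf N X → SyzygyClosure p N

theorem IsGP.exists_class {M : Mdl R} (hM : IsGP M) : ∃ p : Mdl R → Prop, p M ∧
    (∀ X, p X → ExtVanishes X) ∧ (∀ X, p X → ∃ N, p N ∧ SyzygyOf N X) ∧
    (∀ X, p X → ∃ Y, p Y ∧ SyzygyOf X Y) := by
  obtain ⟨P, d, hP, hd, hQ, ⟨e⟩⟩ := hM
  have hdd : ∀ i x, d i (d (i + 1) x) = 0 := fun i x => by
    have : d (i + 1) x ∈ ker (d i) := by rw [← hd]; exact ⟨x, rfl⟩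
    exact this
  let π : ∀ i, P (i + 1 + 1) →ₗ[R] ker (d i) := fun i => (d (i + 1)).codRestrict _ (hdd i)
  have hπ : ∀ i, Surjective (π i) := by
    rintro i ⟨x, hx⟩
    rw [← hd] at hx
    obtain ⟨y, rfl⟩ := hx
    exact ⟨y, rfl⟩
  have hex : ∀ i, Exact (ker (d (i + 1))).subtype (π i) := by
    intro i
    rw [LinearMap.exact_iff, Submodule.range_subtype]
    exact ker_codRestrict _ _ _
  have hs : ∀ i, SyzygyOf (⟨ker (d (i + 1))⟩ : Mdl R) ⟨ker (d i)⟩ := fun i =>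
    ⟨P (i + 1 + 1), (ker (d (i + 1))).subtype, π i, hP _, Subtype.val_injective, hπ i, hex i⟩
  refine ⟨fun X => ∃ i, Nonempty (X ≃ₗ[R] ker (d i)), ⟨0, ⟨e⟩⟩, ?_, ?_, ?_⟩
  · rintro X ⟨i, ⟨e⟩⟩
    have : Module.Projective R (P (i + 1 + 1)) := (hP _).1
    refine ExtVanishes.of_presentation (N := ⟨ker (d (i + 1))⟩) (P := P (i + 1 + 1))
      (j := (ker (d (i + 1))).subtype)
      (π := e.symm.toLinearMap ∘ₗ π i) (e.symm.surjective.comp (hπ i)) ?_ ?_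
    · intro x
      exact (e.symm.map_eq_zero_iff (x := π i x)).trans (hex i x)
    · intro Q hQ' u
      obtain ⟨h, hh⟩ := hQ Q hQ' (i + 1 + 1) (u ∘ₗ π (i + 1)) (by
        ext x
        have : π (i + 1) (d (i + 1 + 1 + 1) x) = 0 := Subtype.ext (hdd _ x)
        simp [this])
      refine ⟨h, LinearMap.ext fun x => ?_⟩
      obtain ⟨y, rfl⟩ := hπ (i + 1) x
      exact LinearMap.congr_fun hh y
  · rintro X ⟨i, ⟨e⟩⟩
    exact ⟨⟨ker (d (i + 1))⟩, ⟨_, ⟨LinearEquiv.refl R _⟩⟩, (hs i).congr (LinearEquiv.refl R _) e.symm⟩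
  · rintro X ⟨i, ⟨e⟩⟩
    obtain ⟨i, rfl⟩ : ∃ k, i = k + 1 := ⟨i - 1, by ring⟩
    exact ⟨⟨ker (d i)⟩, ⟨_, ⟨LinearEquiv.refl R _⟩⟩, (hs i).congr e.symm (LinearEquiv.refl R _)⟩

theorem IsGP.extVanishes {M : Mdl R} (hM : IsGP M) : ExtVanishes M := by
  obtain ⟨p, hp, h, -, -⟩ := hM.exists_class
  exact h _ hp

theorem IsGP.finite [IsNoetherianRing R] {M : Mdl R} (hM : IsGP M) : Module.Finite R M := by
  obtain ⟨P, d, hP, -, -, ⟨e⟩⟩ := hM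
  have := (hP (0 + 1)).2
  exact Module.Finite.equiv e.symm

theorem IsGP.congr {M N : Mdl R} (hM : IsGP M) (e : M ≃ₗ[R] N) : IsGP N := by
  obtain ⟨P, d, hP, hd, hQ, ⟨e'⟩⟩ := hM
  exact ⟨P, d, hP, hd, hQ, ⟨e.symm.trans e'⟩⟩

theorem SyzygyOf.exists_of_finite [IsNoetherianRing R] (M : Mdl R) [Module.Finite R M] :
    ∃ N : Mdl R, SyzygyOf N M := by
  obtain ⟨n, f, hf⟩ := Module.Finite.exists_fin' R M
  exact ⟨_, SyzygyOf.of_ker (P := ⟨Fin n → R⟩) ⟨inferInstanceAs (Module.Projective R (Fin n → R)),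
    inferInstanceAs (Module.Finite R (Fin n → R))⟩ f hf⟩

theorem SyzygyOf.finite [IsNoetherianRing R] {N X : Mdl R} (h : SyzygyOf N X) :
    Module.Finite R N := by
  obtain ⟨F, j, π, ⟨-, hF⟩, hj, -, -⟩ := h
  exact Module.Finite.of_injective j hj

/-- A syzygy of a Gorenstein projective module is Gorenstein projective. -/
theorem IsGP.syzygy [IsNoetherianRing R] {M N : Mdl R} (hM : IsGP M) (h : SyzygyOf N M) :
    IsGP N := by
  obtain ⟨p, hpM, hext, hl, hr⟩ := hM.exists_class
  have key : ∀ X, SyzygyClosure p X → Module.Finite R X ∧ ∃ Y P P' : Mdl R, p Y ∧ FGProj P ∧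
      FGProj P' ∧ Nonempty ((X × P) ≃ₗ[R] (Y × P')) := by
    intro X hX
    induction hX with
    | @base X hX =>
      obtain ⟨Y, -, hY⟩ := hr X hX
      have hz : FGProj (⟨PUnit⟩ : Mdl R) := ⟨inferInstanceAs (Module.Projective R PUnit),
        inferInstanceAs (Module.Finite R PUnit)⟩
      exact ⟨hY.finite, X, ⟨PUnit⟩, ⟨PUnit⟩, hX, hz, hz, ⟨LinearEquiv.refl R _⟩⟩
    | @syz N X _ hN ih =>
      obtain ⟨-, Y, P, P', hY, hP, hP', ⟨e⟩⟩ := ih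
      obtain ⟨Z, hZ, hZY⟩ := hl Y hY
      obtain ⟨F, G, hF, hG, he⟩ := ((hN.prod hP).congr (LinearEquiv.refl R _) e).schanuel
        (hZY.prod hP')
      exact ⟨hN.finite, Z, G, F, hZ, hG, hF, he⟩
  refine IsGP.of_class (SyzygyClosure p) (fun X hX => ?_) (fun X hX => ?_) (fun X hX => ?_)
    (SyzygyClosure.syz (SyzygyClosure.base hpM) h)
  · obtain ⟨-, Y, P, P', hY, hP, hP', ⟨e⟩⟩ := key X hX
    obtain ⟨Z, -, hZY⟩ := hl Y hY
    exact (hext Y hY).of_equiv_prod hP' e Z hZY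
  · have := (key X hX).1
    obtain ⟨N, hN⟩ := SyzygyOf.exists_of_finite X
    exact ⟨N, SyzygyClosure.syz hX hN, hN⟩
  · cases hX with
    | base hX =>
      obtain ⟨Y, hY, h⟩ := hr X hX
      exact ⟨Y, SyzygyClosure.base hY, h⟩
    | syz hX h => exact ⟨_, hX, h⟩

theorem mem_smul_top_of_forall_dual {P : Type*} [AddCommGroup P] [Module R P]
    [Module.Projective R P] {x : P} {I : Ideal R} (h : ∀ l : P →ₗ[R] R, l x ∈ I) :
    x ∈ I • (⊤ : Submodule R P) := by
  obtain ⟨s, hs⟩ := Module.projective_def'.1 (inferInstance : Module.Projective R P)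
  have hx : Finsupp.linearCombination R _root_.id (s x) = x := LinearMap.congr_fun hs x
  rw [← hx, Finsupp.linearCombination_apply]
  exact Submodule.sum_mem _ fun p _ =>
    Submodule.smul_mem_smul (h (Finsupp.lapply p ∘ₗ s)) Submodule.mem_top

theorem IsProjCover.comp_equiv {P M N : Mdl R} {p : P →ₗ[R] M} (hp : IsProjCover p)
    (e : M ≃ₗ[R] N) : IsProjCover (P := P) (M := N) (e.toLinearMap ∘ₗ p) := by
  refine ⟨hp.1, e.surjective.comp hp.2.1, ?_⟩
  rw [ker_comp_of_ker_eq_bot _ e.ker]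
  exact hp.2.2

/-- The kernel of a surjection from a projective module onto `B × Q` is the minimal syzygy of
`B` plus a projective module. -/
theorem exists_ker_equiv_prod {E B Q P PB : Mdl R} (e : E ≃ₗ[R] (B × Q)) (hQ : FGProj Q)
    {θ : P →ₗ[R] E} (hP : FGProj P) (hθ : Surjective θ) {pB : PB →ₗ[R] B} (hpB : IsProjCover pB) :
    ∃ (Q' : Mdl R) (ℓ : P →ₗ[R] PB) (m : PB →ₗ[R] P) (ε : ker θ ≃ₗ[R] (ker pB × Q')),
      FGProj Q' ∧ (∀ x, pB (ℓ x) = (e (θ x)).1) ∧ (∀ b, θ (m b) = e.symm (pB b, 0)) ∧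
      (∀ k, ((ε k).1 : PB) = ℓ k) ∧ ∀ b : ker pB, (ε.symm (b, 0) : P) = m b := by
  obtain ⟨hPBp, hpBs, hpBk⟩ := hpB
  obtain ⟨_, _⟩ := hQ
  obtain ⟨_, _⟩ := hP
  obtain ⟨_, _⟩ := hPBp
  let c : (PB × Q) →ₗ[R] E := e.symm.toLinearMap ∘ₗ pB.prodMap LinearMap.id
  have hcs : Surjective c := e.symm.surjective.comp (hpBs.prodMap surjective_id)
  have hc : ∀ x, e (c x) = (pB x.1, x.2) := fun x => by simp [c]
  obtain ⟨l, hl⟩ := Module.projective_lifting_property c θ hcs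
  have hl' : ∀ x, c (l x) = θ x := fun x => LinearMap.congr_fun hl x
  have hel : ∀ x, e (θ x) = (pB (l x).1, (l x).2) := fun x => by rw [← hl', hc]
  have hls : Surjective l := by
    have h1 : ∀ z : PB × Q, ∃ x, ∃ k ∈ ker pB, l x + (k, 0) = z := fun z => by
      obtain ⟨x, hx⟩ := hθ (c z)
      have h2 : (pB (l x).1, (l x).2) = (pB z.1, z.2) := by rw [← hel, hx, hc]
      refine ⟨x, z.1 - (l x).1, ?_, ?_⟩
      · rw [mem_ker, map_sub, sub_eq_zero]
        exact (congrArg Prod.fst h2).symm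
      · exact Prod.ext (by simp) (by simpa using congrArg Prod.snd h2)
    have h3 : (range l).comap (inl R PB Q) = ⊤ := hpBk _ (top_le_iff.1 fun b _ => by
      obtain ⟨x, k, hk, hxk⟩ := h1 (b, 0)
      refine Submodule.mem_sup.2 ⟨b - k, ⟨x, ?_⟩, k, hk, by simp⟩
      rw [map_sub, inl_apply, inl_apply, ← hxk, add_sub_cancel_right])
    intro z
    obtain ⟨x, k, -, hxk⟩ := h1 z
    obtain ⟨x', hx'⟩ : k ∈ (range l).comap (inl R PB Q) := h3 ▸ Submodule.mem_top
    exact ⟨x + x', by rw [map_add, hx', inl_apply, hxk]⟩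
  obtain ⟨m, hm⟩ := l.exists_rightInverse_of_surjective (range_eq_top.2 hls)
  have hm' : ∀ z, l (m z) = z := fun z => LinearMap.congr_fun hm z
  have hker : ∀ k : ker θ, (pB (l k).1, (l k).2) = (0, 0) := fun k => by
    rw [← hel, mem_ker.1 k.2, map_zero]; rfl
  have hk1 : ∀ k : ker θ, (l k).1 ∈ ker pB := fun k => congrArg Prod.fst (hker k)
  have hk2 : ∀ k : ker θ, (l k).2 = 0 := fun k => congrArg Prod.snd (hker k)
  have hθm : ∀ b, θ (m (b, 0)) = e.symm (pB b, 0) := fun b => by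
    rw [LinearEquiv.eq_symm_apply, hel, hm']
  have hQ' : FGProj (⟨ker l⟩ : Mdl R) := by
    let r : P →ₗ[R] ker l := (LinearMap.id - m ∘ₗ l).codRestrict _ (fun x => by simp [hm'])
    have hr : r ∘ₗ (ker l).subtype = LinearMap.id := by
      ext x
      simp [r]
    exact ⟨Module.Projective.of_split _ r hr,
      Module.Finite.of_surjective r fun x => ⟨x, LinearMap.congr_fun hr x⟩⟩
  let f1 : ker θ →ₗ[R] ker pB :=
    (fst R PB Q ∘ₗ l ∘ₗ (ker θ).subtype).codRestrict _ (fun k => hk1 k)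
  let f2 : ker θ →ₗ[R] ker l :=
    ((LinearMap.id - m ∘ₗ l) ∘ₗ (ker θ).subtype).codRestrict _ (fun k => by simp [hm'])
  let g : (ker pB × ker l) →ₗ[R] ker θ :=
    ((m ∘ₗ inl R PB Q ∘ₗ (ker pB).subtype).coprod (ker l).subtype).codRestrict _ (by
      rintro ⟨⟨b, hb⟩, ⟨x, hx⟩⟩
      have hx' : l x = 0 := hx
      have : θ x = 0 := by rw [← hl', hx', map_zero]
      have hb' : pB b = 0 := hb
      simp [hθm, hb', this])
  have hf1 : ∀ k, (f1 k : PB) = (l k).1 := fun _ => rfl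
  have hf2 : ∀ k, (f2 k : P) = k - m (l k) := fun _ => rfl
  have hg : ∀ z, (g z : P) = m (z.1, 0) + z.2 := fun _ => rfl
  have hlg : ∀ z, l (g z) = ((z.1 : PB), (0 : Q)) := fun z => by
    rw [hg, map_add, hm', mem_ker.1 z.2.2, add_zero]
  refine ⟨⟨ker l⟩, fst R PB Q ∘ₗ l, m ∘ₗ inl R PB Q,
    LinearEquiv.ofLinearMap (f1.prod f2) g ?_ ?_, hQ', fun x => by simp [hel], hθm,
    fun k => rfl, fun b => ?_⟩
  · refine LinearMap.ext fun z => Prod.ext (Subtype.ext ?_) (Subtype.ext ?_)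
    · exact (hf1 _).trans (by rw [hlg]; rfl)
    · exact (hf2 _).trans (by rw [hlg, hg, add_sub_cancel_left]; rfl)
  · refine LinearMap.ext fun k => Subtype.ext ((hg _).trans ?_)
    have : ((l k).1, (0 : Q)) = l k := Prod.ext rfl (hk2 k).symm
    change m ((l k).1, 0) + (k - m (l k)) = k
    rw [this, add_sub_cancel]
  · exact (hg _).trans (add_zero _)

theorem bijective_of_surjective_end {M : Type*} [AddCommGroup M] [Module R M]
    [Module.Finite R M] {f : M →ₗ[R] M} (h : Surjective f) : Bijective f :=
  ⟨OrzechProperty.injective_of_surjective_endomorphism f h, h⟩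

end GorensteinProjective

section LocalRing

open IsLocalRing

variable {R : Type} [CommRing R] [IsLocalRing R]

/-- No functional on `M` takes a unit value; for finitely generated `M` this means that
`M` has no nonzero free direct summand. -/
def IsStable (M : Mdl R) : Prop :=
  ∀ (l : M →ₗ[R] R) (x : M), l x ∈ maximalIdeal R

theorem eq_top_of_sup_smul_top {M : Type*} [AddCommGroup M] [Module R M] [Module.Finite R M]
    {N : Submodule R M} (h : ∀ x, ∃ y ∈ N, x - y ∈ maximalIdeal R • (⊤ : Submodule R M)) :
    N = ⊤ := by
  refine top_le_iff.1 (Submodule.le_of_le_smul_of_le_jacobson_bot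
    (I := maximalIdeal R) Module.Finite.fg_top (maximalIdeal_le_jacobson _) fun x _ => ?_)
  obtain ⟨y, hy, hxy⟩ := h x
  exact Submodule.mem_sup.2 ⟨y, hy, x - y, hxy, by abel⟩

theorem IsStable.of_surjective {M N : Mdl R} (hM : IsStable M) (f : M →ₗ[R] N)
    (hf : Surjective f) : IsStable N := by
  intro l x
  obtain ⟨y, rfl⟩ := hf x
  exact hM (l ∘ₗ f) y

theorem IsStable.subsingleton {M P : Mdl R} [Module.Finite R M] [Module.Projective R P]
    (hM : IsStable M) (f : M →ₗ[R] P) (hf : Surjective f) : Subsingleton P := by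
  have : Module.Finite R P := Module.Finite.of_surjective f hf
  have h : (⊥ : Submodule R P) = ⊤ := eq_top_of_sup_smul_top fun x => ⟨0, rfl, by
    simpa using mem_smul_top_of_forall_dual fun l => hM.of_surjective f hf l x⟩
  exact (Submodule.subsingleton_iff R).1 (subsingleton_of_bot_eq_top h)

theorem Superfluous.dual_mem_maximalIdeal {P : Type} [AddCommGroup P] [Module R P]
    {K : Submodule R P} (hK : Superfluous K) (l : P →ₗ[R] R) {x : P} (hx : x ∈ K) :
    l x ∈ maximalIdeal R := by
  by_contra h
  obtain ⟨u, hu⟩ : IsUnit (l x) := by simpa using h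
  have h1 : ker l = ⊤ := hK _ (top_le_iff.1 fun y _ => Submodule.mem_sup.2
    ⟨y - (l y * ↑u⁻¹) • x, by simp [← hu], _, K.smul_mem (l y * ↑u⁻¹) hx, by simp⟩)
  rw [ker_eq_top] at h1
  exact h (by simp [h1])

theorem IsProjCover.isStable_ker {P M : Mdl R} {p : P →ₗ[R] M} (hp : IsProjCover p)
    (hM : ExtVanishes M) : IsStable (⟨ker p⟩ : Mdl R) := by
  intro l x
  obtain ⟨h, hh⟩ := hM ⟨ker p⟩ P (ker p).subtype p Subtype.val_injective hp.2.1
    (exact_subtype_ker_map p) ⟨R⟩ (inferInstanceAs (Module.Projective R R)) l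
  rw [← hh]
  exact hp.2.2.dual_mem_maximalIdeal h x.2

theorem superfluous_of_le_smul_top {P : Type} [AddCommGroup P] [Module R P] [Module.Finite R P]
    {K : Submodule R P} (hK : K ≤ maximalIdeal R • (⊤ : Submodule R P)) : Superfluous K := by
  intro N hN
  refine eq_top_of_sup_smul_top fun x => ?_
  obtain ⟨y, hy, z, hz, rfl⟩ := Submodule.mem_sup.1 (hN ▸ Submodule.mem_top : x ∈ N ⊔ K)
  exact ⟨y, hy, by simpa using hK hz⟩

theorem exists_isProjCover (M : Mdl R) [Module.Finite R M] :
    ∃ (P : Mdl R) (p : P →ₗ[R] M), IsProjCover p := by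
  classical
  have hex : ∃ n, ∃ f : (Fin n → R) →ₗ[R] M, Surjective f := Module.Finite.exists_fin' R M
  obtain ⟨p, hp⟩ := Nat.find_spec hex
  have hmin : ∀ k < Nat.find hex, ¬ ∃ f : (Fin k → R) →ₗ[R] M, Surjective f :=
    fun k hk => Nat.find_min hex hk
  generalize Nat.find hex = n at p hmin
  refine ⟨⟨Fin n → R⟩, p, ⟨inferInstanceAs (Module.Projective R (Fin n → R)),
    inferInstanceAs (Module.Finite R (Fin n → R))⟩, hp, ?_⟩
  refine superfluous_of_le_smul_top fun x hx => ?_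
  suffices h : ∀ i, x i ∈ maximalIdeal R by
    rw [pi_eq_sum_univ' x]
    exact Submodule.sum_mem _ fun i _ => Submodule.smul_mem_smul (h i) Submodule.mem_top
  intro i
  by_contra hi
  obtain ⟨u, hu⟩ : IsUnit (x i) := by simpa using hi
  rcases n with _ | k
  · exact i.elim0
  refine hmin k k.lt_succ_self ⟨p ∘ₗ LinearMap.pi (Fin.insertNth (α := fun _ => (Fin k → R) →ₗ[R] R)
    i 0 fun l => LinearMap.proj l), fun y => ?_⟩
  obtain ⟨w, rfl⟩ := hp y
  refine ⟨fun l => (w - (w i * ↑u⁻¹) • x) (i.succAbove l), ?_⟩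
  have h : LinearMap.pi (Fin.insertNth (α := fun _ => (Fin k → R) →ₗ[R] R)
      i 0 fun l => LinearMap.proj l) (fun l => (w - (w i * ↑u⁻¹) • x) (i.succAbove l)) =
      w - (w i * ↑u⁻¹) • x := by
    funext j
    rcases Fin.eq_self_or_eq_succAbove i j with rfl | ⟨j, rfl⟩
    · simp [← hu]
    · simp
  rw [LinearMap.comp_apply, h, map_sub, map_smul, mem_ker.1 hx, smul_zero, sub_zero]

end LocalRing

section MorphismCategory

variable {R : Type} [CommRing R]

theorem MIso.refl (f : MObj R) : MIso f f :=
  ⟨LinearEquiv.refl R _, LinearEquiv.refl R _, rfl⟩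

theorem MIso.apply {f g : MObj R} {e1 : f.dom ≃ₗ[R] g.dom} {e2 : f.cod ≃ₗ[R] g.cod}
    (h : g.map ∘ₗ (e1 : f.dom →ₗ[R] g.dom) = (e2 : f.cod →ₗ[R] g.cod) ∘ₗ f.map) (a : f.dom) :
    g.map (e1 a) = e2 (f.map a) :=
  LinearMap.congr_fun h a

theorem MIso.symm {f g : MObj R} (h : MIso f g) : MIso g f := by
  obtain ⟨e1, e2, h⟩ := h
  refine ⟨e1.symm, e2.symm, LinearMap.ext fun x => ?_⟩
  have := MIso.apply h (e1.symm x)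
  simp only [LinearEquiv.apply_symm_apply] at this
  simp [this]

theorem MIso.trans {f g h : MObj R} (hfg : MIso f g) (hgh : MIso g h) : MIso f h := by
  obtain ⟨e1, e2, he⟩ := hfg
  obtain ⟨d1, d2, hd⟩ := hgh
  refine ⟨e1.trans d1, e2.trans d2, LinearMap.ext fun x => ?_⟩
  simp [MIso.apply hd, MIso.apply he]

theorem MHom.apply {f g : MObj R} (φ : MHom f g) (a : f.dom) :
    g.map (φ.h1 a) = φ.h2 (f.map a) :=
  LinearMap.congr_fun φ.comm a

def MHom.comp {f g h : MObj R} (ψ : MHom g h) (φ : MHom f g) : MHom f h where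
  h1 := ψ.h1 ∘ₗ φ.h1
  h2 := ψ.h2 ∘ₗ φ.h2
  comm := by ext x; simp [MHom.apply]

theorem MProj.of_equiv_prod {q : MObj R} {Q : Mdl R} [Module.Projective R q.dom]
    [Module.Projective R Q] (e : (q.dom × Q) ≃ₗ[R] q.cod) (he : ∀ p, e (p, 0) = q.map p) :
    MProj q := by
  intro g h π hπ φ
  obtain ⟨a, ha⟩ := Module.projective_lifting_property π.h1 φ.h1 hπ.1
  obtain ⟨b, hb⟩ := Module.projective_lifting_property π.h2 (φ.h2 ∘ₗ e.toLinearMap ∘ₗ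
    inr R q.dom Q) hπ.2
  have ha' : ∀ x, π.h1 (a x) = φ.h1 x := fun x => LinearMap.congr_fun ha x
  have hb' : ∀ x, π.h2 (b x) = φ.h2 (e (0, x)) := fun x => LinearMap.congr_fun hb x
  refine ⟨⟨a, (g.map ∘ₗ a).coprod b ∘ₗ e.symm.toLinearMap, LinearMap.ext fun x => ?_⟩, ha,
    LinearMap.ext fun x => ?_⟩
  · have : e.symm (q.map x) = (x, 0) := by rw [← he, e.symm_apply_apply]
    simp [this]
  · obtain ⟨⟨p, z⟩, rfl⟩ := e.surjective x
    have h1 : e (p, z) = q.map p + e (0, z) := by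
      rw [← he, ← map_add]
      simp
    change π.h2 (((g.map ∘ₗ a).coprod b) (e.symm (e (p, z)))) = φ.h2 (e (p, z))
    rw [e.symm_apply_apply, h1, coprod_apply, map_add, map_add, hb', LinearMap.comp_apply,
      ← MHom.apply, ha', ← MHom.apply]

theorem MProj.projective_dom {q : MObj R} (hq : MProj q) : Module.Projective R q.dom := by
  refine Module.Projective.of_lifting_property'' fun f hf => ?_
  obtain ⟨ψ, hψ, -⟩ := hq ⟨⟨q.dom →₀ R⟩, ⟨PUnit⟩, 0⟩ ⟨q.dom, ⟨PUnit⟩, 0⟩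
    ⟨f, LinearMap.id, by simp⟩ ⟨hf, surjective_id⟩ ⟨LinearMap.id, 0, by simp⟩
  exact ⟨ψ.h1, hψ⟩

theorem MProj.projective_cokMod {q : MObj R} (hq : MProj q) :
    Module.Projective R (CokMod q) := by
  refine Module.Projective.of_lifting_property'' fun f hf => ?_
  obtain ⟨ψ, -, hψ⟩ := hq ⟨⟨PUnit⟩, ⟨CokMod q →₀ R⟩, 0⟩ ⟨⟨PUnit⟩, CokMod q, 0⟩
    ⟨LinearMap.id, f, by simp⟩ ⟨surjective_id, hf⟩
    ⟨0, (range q.map).mkQ, by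
      ext x
      exact ((Submodule.Quotient.mk_eq_zero (range q.map)).2 (mem_range_self q.map x)).symm⟩
  refine ⟨(range q.map).liftQ ψ.h2 ?_, LinearMap.ext fun x => ?_⟩
  · rintro _ ⟨x, rfl⟩
    rw [mem_ker, ← ψ.apply]
    rfl
  · obtain ⟨x, rfl⟩ := (range q.map).mkQ_surjective x
    exact LinearMap.congr_fun hψ x

theorem MProj.of_iso_dsum {f g q : MObj R} (h : MIso f (DSum g q)) (hg : MTrivial g)
    (hq : MProj q) : MProj f := by
  obtain ⟨e1, e2, he⟩ := h
  obtain ⟨_, _⟩ := hg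
  intro a b π hπ φ
  let i1 : q.dom →ₗ[R] f.dom := e1.symm.toLinearMap ∘ₗ inr R g.dom q.dom
  let i2 : q.cod →ₗ[R] f.cod := e2.symm.toLinearMap ∘ₗ inr R g.cod q.cod
  let p1 : f.dom →ₗ[R] q.dom := snd R g.dom q.dom ∘ₗ e1.toLinearMap
  let p2 : f.cod →ₗ[R] q.cod := snd R g.cod q.cod ∘ₗ e2.toLinearMap
  have hip1 : ∀ x, i1 (p1 x) = x := fun x =>
    e1.symm_apply_eq.2 (Prod.ext (Subsingleton.elim _ _) rfl)
  have hip2 : ∀ x, i2 (p2 x) = x := fun x =>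
    e2.symm_apply_eq.2 (Prod.ext (Subsingleton.elim _ _) rfl)
  have hp : ∀ x, q.map (p1 x) = p2 (f.map x) := fun x =>
    congrArg Prod.snd (MIso.apply he x)
  have hi : ∀ x, f.map (i1 x) = i2 (q.map x) := fun x => by
    have h1 : p1 (i1 x) = x := congrArg Prod.snd (e1.apply_symm_apply (0, x))
    rw [← hip2 (f.map (i1 x)), ← hp, h1]
  obtain ⟨ψ, h1, h2⟩ := hq a b π hπ (φ.comp ⟨i1, i2, LinearMap.ext hi⟩)
  refine ⟨ψ.comp ⟨p1, p2, LinearMap.ext hp⟩, LinearMap.ext fun x => ?_, LinearMap.ext fun x => ?_⟩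
  · have := LinearMap.congr_fun h1 (p1 x)
    simpa [MHom.comp, hip1] using this
  · have := LinearMap.congr_fun h2 (p2 x)
    simpa [MHom.comp, hip2] using this

theorem exists_equiv_ker_prod {M : Mdl R} (l : M →ₗ[R] R) {b : M} (hb : l b = 1) :
    ∃ e : M ≃ₗ[R] (ker l × R), (∀ x, ((e x).1 : M) = x - l x • b) ∧ ∀ x, (e x).2 = l x := by
  let f1 : M →ₗ[R] ker l := (LinearMap.id - l.smulRight b).codRestrict _ (by simp [hb])
  let g : (ker l × R) →ₗ[R] M := (ker l).subtype.coprod (toSpanSingleton R M b)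
  have hf1 : ∀ x, (f1 x : M) = x - l x • b := fun _ => rfl
  have hg : ∀ z, g z = z.1 + z.2 • b := fun _ => rfl
  have hlg : ∀ z, l (g z) = z.2 := fun z => by simp [hg, hb]
  refine ⟨LinearEquiv.ofLinearMap (f1.prod l) g ?_ ?_, hf1, fun _ => rfl⟩
  · refine LinearMap.ext fun z => Prod.ext (Subtype.ext ((hf1 _).trans ?_)) (hlg z)
    rw [hlg, hg, add_sub_cancel_right]
    rfl
  · refine LinearMap.ext fun x => (hg _).trans ?_
    change x - l x • b + l x • b = x
    rw [sub_add_cancel]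

section Local

open IsLocalRing

variable [IsLocalRing R]

theorem IsStable.exists_eq_one {M : Mdl R} (h : ¬ IsStable M) :
    ∃ (l : M →ₗ[R] R) (x : M), l x = 1 := by
  simp only [IsStable, not_forall] at h
  obtain ⟨l, x, hx⟩ := h
  obtain ⟨u, hu⟩ : IsUnit (l x) := by simpa using hx
  exact ⟨l, (↑u⁻¹ : R) • x, by simp [← hu]⟩

theorem MIndec.isStable_cok {f : MObj R} (hf : MIndec f) (hnp : ¬ MProj f) {C : Mdl R}
    {c : f.cod →ₗ[R] C} (hc : Surjective c) (hex : Exact f.map c) : IsStable C := by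
  by_contra h
  obtain ⟨l, x, hl⟩ := IsStable.exists_eq_one h
  obtain ⟨b, rfl⟩ := hc x
  obtain ⟨e, he1, he2⟩ := exists_equiv_ker_prod (l ∘ₗ c) hl
  have hlf : ∀ a, (l ∘ₗ c) (f.map a) = 0 := fun a => by simp [hex.apply_apply_eq_zero]
  let g : MObj R := ⟨f.dom, ⟨ker (l ∘ₗ c)⟩, f.map.codRestrict _ hlf⟩
  let q : MObj R := ⟨⟨PUnit⟩, ⟨R⟩, 0⟩
  have hiso : MIso f (DSum g q) := by
    refine ⟨LinearEquiv.prodUnique.symm, e, LinearMap.ext fun a => ?_⟩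
    refine Prod.ext (Subtype.ext ((?_ : f.map a = _).trans (he1 _).symm))
      ((?_ : (0 : R) = _).trans (he2 _).symm)
    · rw [hlf, zero_smul, sub_zero]
    · rw [hlf]
  have hq : MProj q := by
    have : Module.Projective R q.dom := inferInstanceAs (Module.Projective R PUnit)
    have : Module.Projective R (⟨R⟩ : Mdl R) := inferInstanceAs (Module.Projective R R)
    exact MProj.of_equiv_prod (q := q) (Q := ⟨R⟩) (LinearEquiv.uniqueProd : (PUnit × R) ≃ₗ[R] R)
      (fun _ => rfl)
  rcases hf.2 g q hiso with hg | hq'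
  · exact hnp (hq.of_iso_dsum hiso hg)
  · exact not_subsingleton R hq'.2

theorem MIndec.isStable_dom {f : MObj R} (hf : MIndec f) (hnp : ¬ MProj f)
    (hinj : Injective f.map) {C : Mdl R}
    {c : f.cod →ₗ[R] C} (hc : Surjective c) (hex : Exact f.map c) (hC : ExtVanishes C) :
    IsStable f.dom := by
  by_contra h
  obtain ⟨l, a, hl⟩ := IsStable.exists_eq_one h
  obtain ⟨μ, hμ⟩ := hC f.dom f.cod f.map c hinj hc hex ⟨R⟩
    (inferInstanceAs (Module.Projective R R)) l
  have hμ' : ∀ x, μ (f.map x) = l x := fun x => LinearMap.congr_fun hμ x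
  obtain ⟨e, he1, he2⟩ := exists_equiv_ker_prod l hl
  obtain ⟨d, hd1, hd2⟩ := exists_equiv_ker_prod μ (b := f.map a) ((hμ' a).trans hl)
  let g : MObj R := ⟨⟨ker l⟩, ⟨ker μ⟩, (f.map ∘ₗ (ker l).subtype).codRestrict _ (fun x =>
    (hμ' x).trans x.2)⟩
  let q : MObj R := ⟨⟨R⟩, ⟨R⟩, LinearMap.id⟩
  have hiso : MIso f (DSum g q) := by
    refine ⟨e, d, LinearMap.ext fun x => ?_⟩
    refine Prod.ext (Subtype.ext ((?_ : f.map (e x).1 = _).trans (hd1 _).symm))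
      ((?_ : (e x).2 = _).trans (hd2 _).symm)
    · rw [he1, hμ', map_sub, map_smul]
    · rw [he2, hμ']
  have hq : MProj q := by
    have : Module.Projective R q.dom := inferInstanceAs (Module.Projective R R)
    have : Module.Projective R (⟨PUnit⟩ : Mdl R) := inferInstanceAs (Module.Projective R PUnit)
    exact MProj.of_equiv_prod (q := q) (Q := ⟨PUnit⟩) (LinearEquiv.prodUnique : (R × PUnit) ≃ₗ[R] R)
      (fun _ => rfl)
  rcases hf.2 g q hiso with hg | hq'
  · exact hnp (hq.of_iso_dsum hiso hg)
  · exact not_subsingleton R hq'.2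

end Local

end MorphismCategory

section Reduced

open IsLocalRing

variable {R : Type} [CommRing R]

/-- `s` is obtained from `x` by adding a finitely generated projective summand to the codomain. -/
def EnlargesCod (s x : MObj R) : Prop :=
  ∃ Q : Mdl R, FGProj Q ∧ ∃ (e1 : s.dom ≃ₗ[R] x.dom) (e2 : s.cod ≃ₗ[R] (x.cod × Q)),
    ∀ a, (e2 (s.map a)).1 = x.map (e1 a)

/-- `t` is obtained from `y` by adding a finitely generated projective summand to the domain. -/
def EnlargesDom (t y : MObj R) : Prop :=
  ∃ Q : Mdl R, FGProj Q ∧ ∃ (e1 : t.dom ≃ₗ[R] (y.dom × Q)) (e2 : t.cod ≃ₗ[R] y.cod),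
    ∀ b, e2 (t.map (e1.symm (b, 0))) = y.map b

theorem EnlargesCod.of_iso {s s' x : MObj R} (h : EnlargesCod s x) (hs : MIso s' s) :
    EnlargesCod s' x := by
  obtain ⟨Q, hQ, e1, e2, he⟩ := h
  obtain ⟨d1, d2, hd⟩ := hs
  exact ⟨Q, hQ, d1.trans e1, d2.trans e2, fun a => by
    simp only [LinearEquiv.trans_apply, ← MIso.apply hd, he]⟩

theorem EnlargesDom.of_iso {t t' y : MObj R} (h : EnlargesDom t y) (ht : MIso t' t) :
    EnlargesDom t' y := by
  obtain ⟨Q, hQ, e1, e2, he⟩ := h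
  obtain ⟨d1, d2, hd⟩ := ht
  exact ⟨Q, hQ, d1.trans e1, d2.trans e2, fun a => by
    simp only [LinearEquiv.trans_apply, ← MIso.apply hd, LinearEquiv.trans_symm,
      LinearEquiv.apply_symm_apply, he]⟩

theorem fgProj_punit : FGProj (⟨PUnit⟩ : Mdl R) :=
  ⟨inferInstanceAs (Module.Projective R PUnit), inferInstanceAs (Module.Finite R PUnit)⟩

theorem EnlargesCod.refl (s : MObj R) : EnlargesCod s s :=
  ⟨⟨PUnit⟩, fgProj_punit, LinearEquiv.refl R _,
    (LinearEquiv.prodUnique : (s.cod × PUnit) ≃ₗ[R] s.cod).symm, fun _ => rfl⟩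

theorem EnlargesDom.refl (t : MObj R) : EnlargesDom t t :=
  ⟨⟨PUnit⟩, fgProj_punit, (LinearEquiv.prodUnique : (t.dom × PUnit) ≃ₗ[R] t.dom).symm,
    LinearEquiv.refl R _, fun _ => rfl⟩

theorem MIso.dsum_zero (s : MObj R) : MIso s (DSum s ⟨⟨PUnit⟩, ⟨PUnit⟩, LinearMap.id⟩) :=
  ⟨(LinearEquiv.prodUnique : (s.dom × PUnit) ≃ₗ[R] s.dom).symm,
    (LinearEquiv.prodUnique : (s.cod × PUnit) ≃ₗ[R] s.cod).symm, rfl⟩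

theorem mProj_zero : MProj (⟨⟨PUnit⟩, ⟨PUnit⟩, LinearMap.id⟩ : MObj R) :=
  fun _ _ e _ φ => ⟨⟨0, 0, by simp⟩, LinearMap.ext fun _ => (map_zero e.h1).trans (map_zero φ.h1).symm,
    LinearMap.ext fun _ => (map_zero e.h2).trans (map_zero φ.h2).symm⟩

theorem hInj_zero : HInj (⟨⟨PUnit⟩, ⟨PUnit⟩, LinearMap.id⟩ : MObj R) :=
  ⟨⟨PUnit⟩, ⟨PUnit⟩, fgProj_punit, fgProj_punit,
    (LinearEquiv.prodUnique : (PUnit × PUnit) ≃ₗ[R] PUnit).symm, LinearEquiv.refl R _, rfl⟩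

variable [IsLocalRing R]

theorem IsStable.mem_smul_top {M Q : Mdl R} [Module.Projective R Q] (hM : IsStable M)
    (f : M →ₗ[R] Q) (x : M) : f x ∈ maximalIdeal R • (⊤ : Submodule R Q) :=
  mem_smul_top_of_forall_dual fun l => hM (l ∘ₗ f) x

theorem surjective_of_sub_mem_smul_top {M : Type*} [AddCommGroup M] [Module R M]
    [Module.Finite R M] {f : M →ₗ[R] M}
    (h : ∀ x, x - f x ∈ maximalIdeal R • (⊤ : Submodule R M)) : Surjective f :=
  range_eq_top.1 (eq_top_of_sup_smul_top fun x => ⟨f x, ⟨x, rfl⟩, h x⟩)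

/-- `0 → s.dom → s.cod → C → 0` is a short exact sequence of Gorenstein projective modules whose
outer terms have no nonzero projective direct summand. -/
structure IsReducedSeq (s : MObj R) {C : Mdl R} (c : s.cod →ₗ[R] C) : Prop where
  inj : Injective s.map
  surj : Surjective c
  exact : Exact s.map c
  gp_dom : IsGP s.dom
  gp_cod : IsGP s.cod
  gp_cok : IsGP C
  stable_dom : IsStable s.dom
  stable_cok : IsStable C

namespace IsReducedSeq

variable {s : MObj R} {C : Mdl R} {c : s.cod →ₗ[R] C}

theorem exists_equiv_cokMod (h : IsReducedSeq s c) :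
    ∃ e : C ≃ₗ[R] CokMod s, ∀ b, e (c b) = (CokObj s).map b := by
  have hr : range s.map = ker c := h.exact.linearMap_ker_eq.symm
  let e : CokMod s ≃ₗ[R] C :=
    (Submodule.quotEquivOfEq _ _ hr).trans (c.quotKerEquivOfSurjective h.surj)
  exact ⟨e.symm, fun b => (LinearEquiv.symm_apply_eq e).2 rfl⟩

theorem congr (h : IsReducedSeq s c) {s' : MObj R} {C' : Mdl R} {c' : s'.cod →ₗ[R] C'}
    (e1 : s.dom ≃ₗ[R] s'.dom) (e2 : s.cod ≃ₗ[R] s'.cod) (e3 : C ≃ₗ[R] C')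
    (h12 : ∀ a, s'.map (e1 a) = e2 (s.map a)) (h23 : ∀ b, c' (e2 b) = e3 (c b)) :
    IsReducedSeq s' c' where
  inj a a' haa := by
    obtain ⟨a, rfl⟩ := e1.surjective a
    obtain ⟨a', rfl⟩ := e1.surjective a'
    rw [h12, h12] at haa
    rw [h.inj (e2.injective haa)]
  surj z := by
    obtain ⟨b, hb⟩ := h.surj (e3.symm z)
    exact ⟨e2 b, by rw [h23, hb, e3.apply_symm_apply]⟩
  exact b := by
    obtain ⟨b, rfl⟩ := e2.surjective b
    rw [h23, LinearEquiv.map_eq_zero_iff, h.exact b]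
    constructor
    · rintro ⟨a, rfl⟩
      exact ⟨e1 a, h12 a⟩
    · rintro ⟨a, ha⟩
      obtain ⟨a, rfl⟩ := e1.surjective a
      exact ⟨a, e2.injective ((h12 a).symm.trans ha)⟩
  gp_dom := h.gp_dom.congr e1
  gp_cod := h.gp_cod.congr e2
  gp_cok := h.gp_cok.congr e3
  stable_dom := h.stable_dom.of_surjective e1.toLinearMap e1.surjective
  stable_cok := h.stable_cok.of_surjective e3.toLinearMap e3.surjective

theorem cokObj (h : IsReducedSeq s c) : IsReducedSeq s (C := CokMod s) (CokObj s).map := by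
  obtain ⟨e, he⟩ := h.exists_equiv_cokMod
  exact h.congr (LinearEquiv.refl R _) (LinearEquiv.refl R _) e (fun _ => rfl) fun b => (he b).symm

theorem enlargesDom_cokObj (h : IsReducedSeq s c) {y : MObj R}
    (hy : EnlargesDom ⟨s.cod, C, c⟩ y) : EnlargesDom (CokObj s) y := by
  obtain ⟨e, he⟩ := h.exists_equiv_cokMod
  exact hy.of_iso (MIso.symm ⟨LinearEquiv.refl R _, e, LinearMap.ext fun b => (he b).symm⟩)

theorem inG (h : IsReducedSeq s c) : InG s :=
  ⟨h.inj, h.gp_dom, h.cokObj.gp_cok⟩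

variable [IsNoetherianRing R]

theorem mNoProjSummand (h : IsReducedSeq s c) : MNoProjSummand s := by
  rintro g q ⟨e1, e2, he⟩ hq
  have := hq.projective_dom
  have := hq.projective_cokMod
  have := h.gp_dom.finite
  have := h.cokObj.gp_cok.finite
  have hd : Subsingleton q.dom := h.stable_dom.subsingleton (snd R g.dom q.dom ∘ₗ e1.toLinearMap)
    (Prod.snd_surjective.comp e1.surjective)
  have hr : range s.map ≤ ker ((CokObj q).map ∘ₗ snd R g.cod q.cod ∘ₗ e2.toLinearMap) := by
    rintro _ ⟨a, rfl⟩
    have h2 : (e2 (s.map a)).2 = q.map (e1 a).2 := congrArg Prod.snd (MIso.apply he a).symm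
    change (CokObj q).map (e2 (s.map a)).2 = 0
    rw [h2]
    exact (Submodule.Quotient.mk_eq_zero (range q.map)).2 (mem_range_self q.map _)
  have hc : Subsingleton (CokMod q) := h.cokObj.stable_cok.subsingleton
    ((range s.map).liftQ _ hr) (by
      intro z
      obtain ⟨z, rfl⟩ := (range q.map).mkQ_surjective z
      refine ⟨(CokObj s).map (e2.symm (0, z)), ?_⟩
      exact congrArg (fun w : g.cod × q.cod => (CokObj q).map w.2) (e2.apply_symm_apply (0, z)))
  refine ⟨hd, subsingleton_of_forall_eq 0 fun z => ?_⟩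
  obtain ⟨a, rfl⟩ := (Submodule.Quotient.mk_eq_zero (range q.map)).1
    (hc.elim ((CokObj q).map z) 0)
  rw [Subsingleton.elim a 0, map_zero]

theorem isRedGCover (h : IsReducedSeq s c) {x : MObj R} (hx : EnlargesCod s x) :
    IsRedGCover s x := by
  obtain ⟨Q, hQ, e1, e2, he⟩ := hx
  have : Module.Projective R Q := hQ.1
  have := h.gp_cod.finite
  refine ⟨s, ⟨e1, fst R x.cod Q ∘ₗ e2.toLinearMap, LinearMap.ext fun a => (he a).symm⟩,
    ⟨⟨h.inG, ?_⟩, ?_⟩, _, mProj_zero, MIso.dsum_zero s, h.mNoProjSummand⟩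
  · intro g hg ψ
    let ξ : g.dom →ₗ[R] s.dom := e1.symm.toLinearMap ∘ₗ ψ.h1
    have hξ : ∀ a, e1 (ξ a) = ψ.h1 a := fun a => e1.apply_symm_apply _
    obtain ⟨τ, hτ⟩ := hg.2.2.extVanishes g.dom g.cod g.map (range g.map).mkQ hg.1
      (range g.map).mkQ_surjective g.map.exact_map_mkQ_range Q hQ.1
      (snd R x.cod Q ∘ₗ e2.toLinearMap ∘ₗ s.map ∘ₗ ξ)
    have hτ' : ∀ a, τ (g.map a) = (e2 (s.map (ξ a))).2 := fun a => LinearMap.congr_fun hτ a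
    refine ⟨⟨ξ, e2.symm.toLinearMap ∘ₗ ψ.h2.prod τ, LinearMap.ext fun a => ?_⟩,
      LinearMap.ext hξ, LinearMap.ext fun b => ?_⟩
    · refine (LinearEquiv.eq_symm_apply e2).2 (Prod.ext ?_ (hτ' a).symm)
      change (e2 (s.map (ξ a))).1 = ψ.h2 (g.map a)
      rw [he, hξ, ψ.apply]
    · exact congrArg Prod.fst (e2.apply_symm_apply _)
  · intro ξ hξ1 hξ2
    have h1 : ∀ a, ξ.h1 a = a := fun a => e1.injective (LinearMap.congr_fun hξ1 a)
    have h2 : ∀ b, (e2 (ξ.h2 b)).1 = (e2 b).1 := fun b => LinearMap.congr_fun hξ2 b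
    let w : s.cod →ₗ[R] Q := snd R x.cod Q ∘ₗ e2.toLinearMap ∘ₗ (LinearMap.id - ξ.h2)
    obtain ⟨w', hw'⟩ := exists_comp_eq_of_ker_le h.surj w (by
      rw [h.exact.linearMap_ker_eq]
      rintro _ ⟨a, rfl⟩
      simp [w, ← ξ.apply, h1])
    have hw : ∀ b, b - ξ.h2 b = e2.symm (0, w' (c b)) := fun b => by
      rw [LinearEquiv.eq_symm_apply, show w' (c b) = w b from LinearMap.congr_fun hw' b]
      refine Prod.ext ?_ rfl
      rw [map_sub, Prod.fst_sub, h2, sub_self]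
    refine ⟨⟨fun a a' haa => by rwa [h1, h1] at haa, fun a => ⟨a, h1 a⟩⟩,
      bijective_of_surjective_end (surjective_of_sub_mem_smul_top fun b => ?_)⟩
    rw [hw]
    exact Submodule.smul_top_le_comap_smul_top _ (e2.symm.toLinearMap ∘ₗ inr R x.cod Q)
      (h.stable_cok.mem_smul_top w' (c b))

theorem mNoHInjSummand (h : IsReducedSeq s c) : MNoHInjSummand ⟨s.cod, C, c⟩ := by
  rintro g q ⟨d1, d2, hd⟩ ⟨P, P', hP, hP', u1, u2, hu⟩
  have := hP.1
  have := hP'.1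
  have := h.gp_dom.finite
  have := h.gp_cok.finite
  have h1 : Subsingleton P := h.stable_cok.subsingleton
    (u2.toLinearMap ∘ₗ snd R g.cod q.cod ∘ₗ d2.toLinearMap)
    (u2.surjective.comp (Prod.snd_surjective.comp d2.surjective))
  have h2 : Subsingleton P' := h.stable_dom.subsingleton
    (snd R P P' ∘ₗ u1.toLinearMap ∘ₗ snd R g.dom q.dom ∘ₗ d1.toLinearMap ∘ₗ s.map) (by
      intro z
      have hz : c (d1.symm (0, u1.symm (0, z))) = 0 := by
        apply d2.injective
        have h0 : q.map (u1.symm (0, z)) = 0 := u2.injective <|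
          (MIso.apply hu _).symm.trans <|
            (congrArg Prod.fst (u1.apply_symm_apply (0, z))).trans (map_zero u2).symm
        refine (MIso.apply hd _).symm.trans ((congrArg (DSum g q).map (d1.apply_symm_apply _)).trans
          (Eq.trans ?_ (map_zero d2).symm))
        exact Prod.ext (map_zero g.map) h0
      obtain ⟨a, ha⟩ := (h.exact _).1 hz
      refine ⟨a, ?_⟩
      have h2 : (d1 (s.map a)).2 = u1.symm (0, z) :=
        congrArg Prod.snd (((congrArg d1 ha)).trans (d1.apply_symm_apply _))
      exact congrArg Prod.snd ((congrArg u1 h2).trans (u1.apply_symm_apply _)))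
  have h3 : Subsingleton (P × P') := inferInstance
  exact ⟨Injective.subsingleton (β := P × P') u1.injective, Injective.subsingleton (β := P) u2.injective⟩

theorem isRedEEnvelope (h : IsReducedSeq s c) {y : MObj R} (hy : EnlargesDom ⟨s.cod, C, c⟩ y) :
    IsRedEEnvelope ⟨s.cod, C, c⟩ y := by
  obtain ⟨Q, hQ, e1, e2, he⟩ := hy
  change s.cod ≃ₗ[R] (y.dom × Q) at e1
  change C ≃ₗ[R] y.cod at e2
  have he' : ∀ b, e2 (c (e1.symm (b, 0))) = y.map b := he
  have : Module.Projective R Q := hQ.1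
  have := h.gp_cod.finite
  refine ⟨⟨s.cod, C, c⟩, ⟨e1.symm.toLinearMap ∘ₗ inl R y.dom Q, e2.symm, LinearMap.ext fun b =>
    (LinearEquiv.eq_symm_apply e2).2 (he' b)⟩, ⟨⟨⟨⟨h.gp_cod, h.gp_cok⟩, h.surj⟩, ?_⟩, ?_⟩, _,
    hInj_zero, MIso.dsum_zero _, h.mNoHInjSummand⟩
  · intro g hg ψ
    obtain ⟨τ, hτ⟩ := Module.projective_lifting_property g.map
      (ψ.h2 ∘ₗ e2.toLinearMap ∘ₗ c ∘ₗ e1.symm.toLinearMap ∘ₗ inr R y.dom Q) hg.2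
    have hτ' : ∀ z, g.map (τ z) = ψ.h2 (e2 (c (e1.symm (0, z)))) := fun z =>
      LinearMap.congr_fun hτ z
    refine ⟨⟨ψ.h1.coprod τ ∘ₗ e1.toLinearMap, ψ.h2 ∘ₗ e2.toLinearMap, LinearMap.ext fun b => ?_⟩,
      LinearMap.ext fun b => ?_, LinearMap.ext fun z => ?_⟩
    · obtain ⟨⟨b, z⟩, rfl⟩ := e1.symm.surjective b
      change g.map (ψ.h1.coprod τ (e1 (e1.symm (b, z)))) = ψ.h2 (e2 (c (e1.symm (b, z))))
      have hbz : (b, z) = (b, 0) + (0, z) := by simp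
      rw [e1.apply_symm_apply, coprod_apply, map_add, hτ', ψ.apply, ← he', ← map_add, ← map_add,
        ← map_add, ← map_add, ← hbz]
    · change ψ.h1.coprod τ (e1 (e1.symm (b, 0))) = _
      simp
    · exact congrArg ψ.h2 (e2.apply_symm_apply z)
  · intro ξ hξ1 hξ2
    have h2 : ∀ z, ξ.h2 z = z := fun z => by
      obtain ⟨z, rfl⟩ := e2.symm.surjective z
      exact LinearMap.congr_fun hξ2 z
    have h1 : ∀ b, ξ.h1 (e1.symm (b, 0)) = e1.symm (b, 0) := fun b => LinearMap.congr_fun hξ1 b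
    let δ : s.cod →ₗ[R] s.cod := ξ.h1 - LinearMap.id
    have hδ : ∀ b, δ b = ξ.h1 b - b := fun _ => rfl
    obtain ⟨κ, hκ⟩ := exists_comp_eq_of_exact h.inj h.exact δ (fun b => by
      have : c (ξ.h1 b) = ξ.h2 (c b) := ξ.apply b
      rw [hδ, map_sub, this, h2, sub_self])
    have hκ' : ∀ b, s.map (κ b) = δ b := fun b => LinearMap.congr_fun hκ b
    have hδe : ∀ b, δ b = δ (e1.symm (0, (e1 b).2)) := fun b => by
      obtain ⟨⟨b, z⟩, rfl⟩ := e1.symm.surjective b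
      have hbz : (b, z) = (b, 0) + (0, z) := by simp
      rw [e1.apply_symm_apply, hbz, map_add, map_add, hδ (e1.symm (b, 0)), h1, sub_self]
      simp
    have hs : Surjective (ξ.h1 ∘ₗ (LinearMap.id - δ)) := by
      refine surjective_of_sub_mem_smul_top fun b => ?_
      have hb : b - (ξ.h1 ∘ₗ (LinearMap.id - δ)) b = δ (δ b) := by
        change b - ξ.h1 (b - δ b) = _
        rw [hδ (δ b), map_sub, hδ]
        abel
      rw [hb, hδe (δ b), ← hκ' b]
      exact Submodule.smul_top_le_comap_smul_top _
        (δ ∘ₗ e1.symm.toLinearMap ∘ₗ inr R y.dom Q)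
        (h.stable_dom.mem_smul_top (snd R y.dom Q ∘ₗ e1.toLinearMap ∘ₗ s.map) (κ b))
    exact ⟨bijective_of_surjective_end (Surjective.of_comp hs),
      fun z z' hz => by rwa [h2, h2] at hz, fun z => ⟨z, h2 z⟩⟩

end IsReducedSeq

end Reduced

section Syzygy

variable {R : Type} [CommRing R]

theorem exists_ker_equiv {X X' Y : Type*} [AddCommGroup X] [AddCommGroup X'] [AddCommGroup Y]
    [Module R X] [Module R X'] [Module R Y] {p : X →ₗ[R] Y} {p' : X' →ₗ[R] Y} (e : X ≃ₗ[R] X')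
    (h : p' ∘ₗ e.toLinearMap = p) : ∃ ε : ker p ≃ₗ[R] ker p', ∀ k, (ε k : X') = e k := by
  subst h
  refine ⟨e.ofSubmodules _ _ ?_, fun k => rfl⟩
  rw [ker_comp]
  exact Submodule.map_comap_eq_of_surjective e.surjective _

/-- Minimal syzygies in the morphism category are unique up to isomorphism. -/
theorem MSyz1.iso {f g g' : MObj R} (h : MSyz1 f g) (h' : MSyz1 f g') : MIso g g' := by
  obtain ⟨q, φ, ⟨hq, hφ, hmin⟩, k, hk, hg⟩ := h
  obtain ⟨q', φ', ⟨hq', hφ', hmin'⟩, k', hk', hg'⟩ := h'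
  obtain ⟨α, hα1, hα2⟩ := hq q' f φ' hφ' φ
  obtain ⟨β, hβ1, hβ2⟩ := hq' q f φ hφ φ'
  obtain ⟨hβα1, hβα2⟩ := hmin (β.comp α)
    (by change φ.h1 ∘ₗ β.h1 ∘ₗ α.h1 = _; rw [← LinearMap.comp_assoc, hβ1, hα1])
    (by change φ.h2 ∘ₗ β.h2 ∘ₗ α.h2 = _; rw [← LinearMap.comp_assoc, hβ2, hα2])
  obtain ⟨hαβ1, hαβ2⟩ := hmin' (α.comp β)
    (by change φ'.h1 ∘ₗ α.h1 ∘ₗ β.h1 = _; rw [← LinearMap.comp_assoc, hα1, hβ1])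
    (by change φ'.h2 ∘ₗ α.h2 ∘ₗ β.h2 = _; rw [← LinearMap.comp_assoc, hα2, hβ2])
  have h1 : Bijective α.h1 := ⟨Injective.of_comp hβα1.1, Surjective.of_comp hαβ1.2⟩
  have h2 : Bijective α.h2 := ⟨Injective.of_comp hβα2.1, Surjective.of_comp hαβ2.2⟩
  obtain ⟨ε1, hε1⟩ := exists_ker_equiv (LinearEquiv.ofBijective α.h1 h1) hα1
  obtain ⟨ε2, hε2⟩ := exists_ker_equiv (LinearEquiv.ofBijective α.h2 h2) hα2
  refine hg.trans (MIso.trans ?_ hg'.symm)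
  refine ⟨ε1, ε2, LinearMap.ext fun (a : ker φ.h1) => Subtype.ext ?_⟩
  have e1 : (k' (ε1 a) : q'.cod) = q'.map (ε1 a) := LinearMap.congr_fun hk' (ε1 a)
  have e2 : (k a : q.cod) = q.map a := LinearMap.congr_fun hk a
  refine e1.trans (Eq.trans ?_ (hε2 (k a)).symm)
  rw [hε1, e2]
  exact α.apply _

section Horseshoe

variable {s : MObj R} {C PA PC : Mdl R} {c : s.cod →ₗ[R] C} (pA : PA →ₗ[R] s.dom)
  (t : PC →ₗ[R] s.cod) (pC : PC →ₗ[R] C)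

/-- The horseshoe cover of the codomain of `s`. -/
def horseshoe : (⟨PA × PC⟩ : Mdl R) →ₗ[R] s.cod := (s.map ∘ₗ pA).coprod t

theorem horseshoe_apply (a : PA) (z : PC) : horseshoe pA t (a, z) = s.map (pA a) + t z := rfl

theorem horseshoe_inl (a : PA) : horseshoe pA t (a, 0) = s.map (pA a) := by
  rw [horseshoe_apply, map_zero, add_zero]

/-- The kernel of the cover of `s` given by the horseshoe construction. -/
def horseshoeKer : MObj R where
  dom := ⟨ker pA⟩
  cod := ⟨ker (horseshoe pA t)⟩
  map := (inl R PA PC).restrict fun a ha => by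
    rw [mem_ker] at ha
    exact (horseshoe_inl pA t a).trans (by rw [ha, map_zero])

variable {pA t pC}

theorem Function.Exact.map_horseshoe (hex : Exact s.map c) (ht : c ∘ₗ t = pC)
    (x : (⟨PA × PC⟩ : Mdl R)) : c (horseshoe pA t x) = pC x.2 := by
  rw [← ht, horseshoe_apply pA t x.1 x.2, map_add, hex.apply_apply_eq_zero, zero_add]
  rfl

/-- The map from the kernel of the horseshoe cover to the kernel of `pC`. -/
def horseshoeSnd (hex : Exact s.map c) (ht : c ∘ₗ t = pC) :
    (horseshoeKer pA t).cod →ₗ[R] (⟨ker pC⟩ : Mdl R) :=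
  (snd R PA PC).restrict fun x hx =>
    (hex.map_horseshoe ht x).symm.trans (by rw [mem_ker.1 hx, map_zero])

theorem surjective_horseshoe (hex : Exact s.map c) (ht : c ∘ₗ t = pC) (hA : Surjective pA)
    (hC : Surjective pC) : Surjective (horseshoe pA t) := by
  intro b
  obtain ⟨z, hz⟩ := hC (c b)
  obtain ⟨a, ha⟩ := (hex (b - t z)).1 (by rw [map_sub, ← hz, ← ht]; exact sub_self _)
  obtain ⟨a, rfl⟩ := hA a
  exact ⟨(a, z), by rw [horseshoe_apply, ha, sub_add_cancel]⟩

theorem surjective_horseshoeSnd (hex : Exact s.map c) (ht : c ∘ₗ t = pC) (hA : Surjective pA) :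
    Surjective (horseshoeSnd (pA := pA) hex ht) := by
  rintro ⟨z, hz⟩
  obtain ⟨a, ha⟩ := (hex (t z)).1 ((LinearMap.congr_fun ht z).trans hz)
  obtain ⟨a, rfl⟩ := hA a
  exact ⟨⟨(-a, z), by rw [mem_ker, horseshoe_apply, map_neg, map_neg, ha, neg_add_cancel]⟩, rfl⟩

theorem exact_horseshoeSnd (hinj : Injective s.map) (hex : Exact s.map c) (ht : c ∘ₗ t = pC) :
    Exact (horseshoeKer pA t).map (horseshoeSnd hex ht) := by
  intro x
  constructor
  · intro hx
    obtain ⟨⟨a, z⟩, hk⟩ := x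
    have hz : z = 0 := congrArg Subtype.val hx
    subst hz
    refine ⟨⟨a, hinj ?_⟩, rfl⟩
    rw [map_zero, ← horseshoe_inl pA t]
    exact hk
  · rintro ⟨a, rfl⟩
    rfl

theorem IsProjCover.mProjCover_horseshoe (hex : Exact s.map c)
    (ht : c ∘ₗ t = pC) (hA : IsProjCover pA) (hC : IsProjCover pC) :
    MProjCover (q := ⟨PA, ⟨PA × PC⟩, inl R PA PC⟩) (f := s)
      ⟨pA, horseshoe pA t, LinearMap.ext fun a => (horseshoe_inl pA t a).symm⟩ := by
  obtain ⟨⟨_, _⟩, hAs, hAk⟩ := hA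
  obtain ⟨⟨_, _⟩, hCs, hCk⟩ := hC
  refine ⟨MProj.of_equiv_prod (q := ⟨PA, ⟨PA × PC⟩, inl R PA PC⟩) (LinearEquiv.refl R (PA × PC))
    fun _ => rfl, ⟨hAs, surjective_horseshoe hex ht hAs hCs⟩, fun ξ h1 h2 => ?_⟩
  obtain ⟨ξ1, ξ2, hξ⟩ := ξ
  change PA →ₗ[R] PA at ξ1
  change (PA × PC) →ₗ[R] (PA × PC) at ξ2
  have hξ' : ∀ a, (ξ1 a, (0 : PC)) = ξ2 (a, 0) := fun a => LinearMap.congr_fun hξ a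
  have h1' : ∀ a, pA (ξ1 a) = pA a := fun a => LinearMap.congr_fun h1 a
  have h2' : ∀ x, horseshoe pA t (ξ2 x) = horseshoe pA t x := fun x => LinearMap.congr_fun h2 x
  have hs1 : Surjective ξ1 := range_eq_top.1 <| hAk _ <| top_le_iff.1 fun a _ =>
    Submodule.mem_sup.2 ⟨ξ1 a, ⟨a, rfl⟩, a - ξ1 a, by simp [h1'], by simp⟩
  have hs2 : range (snd R PA PC ∘ₗ ξ2) = ⊤ := hCk _ <| top_le_iff.1 fun z _ =>
    Submodule.mem_sup.2 ⟨(ξ2 (0, z)).2, ⟨(0, z), rfl⟩, z - (ξ2 (0, z)).2, by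
      rw [mem_ker, map_sub, ← hex.map_horseshoe (pA := pA) ht (ξ2 (0, z)), h2',
        hex.map_horseshoe ht, sub_self], by simp⟩
  have hs : Surjective ξ2 := by
    rintro ⟨a, z⟩
    obtain ⟨x, hx⟩ := range_eq_top.1 hs2 z
    obtain ⟨a', ha'⟩ := hs1 (a - (ξ2 x).1)
    refine ⟨(a', 0) + x, ?_⟩
    rw [map_add, ← hξ', ha']
    exact Prod.ext (by simp) (by simpa using hx)
  exact ⟨bijective_of_surjective_end hs1, bijective_of_surjective_end hs⟩

theorem IsProjCover.mSyz1_horseshoe (hex : Exact s.map c)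
    (ht : c ∘ₗ t = pC) (hA : IsProjCover pA) (hC : IsProjCover pC) :
    MSyz1 s (horseshoeKer pA t) :=
  ⟨_, _, hA.mProjCover_horseshoe hex ht hC, (horseshoeKer pA t).map, rfl, MIso.refl _⟩

end Horseshoe

theorem MapSyz1.of_restrict {f : MObj R} {PA PB : Mdl R} {pA : PA →ₗ[R] f.dom}
    {pB : PB →ₗ[R] f.cod} (hA : IsProjCover pA) (hB : IsProjCover pB) {L : PA →ₗ[R] PB}
    (hL : ∀ a, f.map (pA a) = pB (L a)) :
    MapSyz1 f ⟨⟨ker pA⟩, ⟨ker pB⟩, L.restrict (p := ker pA) (q := ker pB) fun a ha => by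
      rw [mem_ker, ← hL, mem_ker.1 ha, map_zero]⟩ :=
  ⟨PA, PB, pA, pB, L, hA, hB, LinearMap.ext hL, _, rfl, MIso.refl _⟩

variable [IsLocalRing R]

theorem IsReducedSeq.horseshoe [IsNoetherianRing R] {s : MObj R} {C PA PC : Mdl R}
    {c : s.cod →ₗ[R] C} (h : IsReducedSeq s c) {pA : PA →ₗ[R] s.dom} {t : PC →ₗ[R] s.cod}
    {pC : PC →ₗ[R] C} (ht : c ∘ₗ t = pC) (hA : IsProjCover pA) (hC : IsProjCover pC) :
    IsReducedSeq (horseshoeKer pA t) (horseshoeSnd h.exact ht) where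
  inj _ _ hab := Subtype.ext (congrArg (fun x => x.1.1) hab)
  surj := surjective_horseshoeSnd h.exact ht hA.2.1
  exact := exact_horseshoeSnd h.inj h.exact ht
  gp_dom := h.gp_dom.syzygy (SyzygyOf.of_ker hA.1 pA hA.2.1)
  gp_cod := h.gp_cod.syzygy (SyzygyOf.of_ker (hA.1.prod hC.1) _
    (surjective_horseshoe h.exact ht hA.2.1 hC.2.1))
  gp_cok := h.gp_cok.syzygy (SyzygyOf.of_ker hC.1 pC hC.2.1)
  stable_dom := hA.isStable_ker h.gp_dom.extVanishes
  stable_cok := hC.isStable_ker h.gp_cok.extVanishes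

/-- `s` is part of a reduced sequence, with `x` and `y` obtained from the two maps of this
sequence by cancelling projective summands of the middle term. -/
def IsReducedTriple (s x y : MObj R) : Prop :=
  ∃ (C : Mdl R) (c : s.cod →ₗ[R] C),
    IsReducedSeq s c ∧ EnlargesCod s x ∧ EnlargesDom ⟨s.cod, C, c⟩ y

theorem IsReducedTriple.of_iso {s s' x y : MObj R} (h : IsReducedTriple s x y) (hs : MIso s s') :
    IsReducedTriple s' x y := by
  obtain ⟨C, c, h, hx, hy⟩ := h
  have hx' := hx.of_iso hs.symm
  obtain ⟨e1, e2, he⟩ := hs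
  refine ⟨C, c ∘ₗ e2.symm.toLinearMap, h.congr e1 e2 (LinearEquiv.refl R _) (MIso.apply he)
    (fun b => congrArg c (e2.symm_apply_apply b)), hx',
    hy.of_iso ⟨e2.symm, LinearEquiv.refl R _, rfl⟩⟩

theorem IsReducedTriple.exists_mapSyz1 [IsNoetherianRing R] {s s' x y : MObj R}
    (h : IsReducedTriple s x y) (hs : MSyz1 s s') :
    ∃ x' y', MapSyz1 x x' ∧ MapSyz1 y y' ∧ IsReducedTriple s' x' y' := by
  obtain ⟨C, c, h, hx, hy⟩ := h
  have := h.gp_dom.finite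
  have := h.gp_cod.finite
  have := h.gp_cok.finite
  obtain ⟨PA, pA, hA⟩ := exists_isProjCover s.dom
  obtain ⟨PC, pC, hC⟩ := exists_isProjCover C
  have := hC.1.1
  obtain ⟨t, ht⟩ := Module.projective_lifting_property c pC h.surj
  have hθ := surjective_horseshoe h.exact ht hA.2.1 hC.2.1
  have hiso := (hA.mSyz1_horseshoe h.exact ht hC).iso hs
  suffices (∃ x', MapSyz1 x x' ∧ EnlargesCod (horseshoeKer pA t) x') ∧
      ∃ y', MapSyz1 y y' ∧
        EnlargesDom ⟨(horseshoeKer pA t).cod, ⟨ker pC⟩, horseshoeSnd h.exact ht⟩ y' by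
    obtain ⟨⟨x', hx1, hx2⟩, y', hy1, hy2⟩ := this
    exact ⟨x', y', hx1, hy1, IsReducedTriple.of_iso ⟨_, _, h.horseshoe ht hA hC, hx2, hy2⟩ hiso⟩
  constructor
  · obtain ⟨Q, hQ, e1, e2, he⟩ := hx
    have : Module.Finite R x.cod :=
      Module.Finite.of_surjective (fst R x.cod Q ∘ₗ e2.toLinearMap)
        (Prod.fst_surjective.comp e2.surjective)
    obtain ⟨PB, pB, hB⟩ := exists_isProjCover x.cod
    obtain ⟨Q', ℓ, m, ε, hQ', hℓ, -, hε, -⟩ :=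
      exists_ker_equiv_prod e2 hQ (hA.1.prod hC.1) hθ hB
    refine ⟨_, MapSyz1.of_restrict (hA.comp_equiv e1) hB (L := ℓ ∘ₗ inl R PA PC) fun a => ?_,
      Q', hQ', LinearEquiv.ofEq _ _ (ker_comp_of_ker_eq_bot _ e1.ker).symm, ε,
      fun a => Subtype.ext (hε _)⟩
    refine Eq.trans ?_ (hℓ (a, 0)).symm
    rw [horseshoe_inl, he]
    rfl
  · obtain ⟨Q, hQ, e1, e2, he⟩ := hy
    have : Module.Finite R y.dom :=
      Module.Finite.of_surjective (fst R y.dom Q ∘ₗ e1.toLinearMap)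
        (Prod.fst_surjective.comp e1.surjective)
    obtain ⟨PB, pB, hB⟩ := exists_isProjCover y.dom
    obtain ⟨Q', ℓ, m, ε, hQ', -, hm, -, hε⟩ :=
      exists_ker_equiv_prod e1 hQ (hA.1.prod hC.1) hθ hB
    refine ⟨_, MapSyz1.of_restrict hB (hC.comp_equiv e2) (L := snd R PA PC ∘ₗ m) fun b => ?_,
      Q', hQ', ε, LinearEquiv.ofEq _ _ (ker_comp_of_ker_eq_bot _ e2.ker).symm,
      fun b => Subtype.ext (congrArg Prod.snd (hε b))⟩
    rw [← he, ← hm]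
    exact congrArg e2 (h.exact.map_horseshoe ht (m b))

theorem IsReducedTriple.exists_chain [IsNoetherianRing R] {n : ℕ} :
    ∀ {F : Fin (n + 1) → MObj R} {x y : MObj R}, IsReducedTriple (F 0) x y →
      (∀ i : Fin n, MSyz1 (F i.castSucc) (F i.succ)) →
      ∃ X Y : Fin (n + 1) → MObj R, X 0 = x ∧ Y 0 = y ∧
        (∀ i : Fin n, MapSyz1 (X i.castSucc) (X i.succ)) ∧
        (∀ i : Fin n, MapSyz1 (Y i.castSucc) (Y i.succ)) ∧
        IsReducedTriple (F (Fin.last n)) (X (Fin.last n)) (Y (Fin.last n)) := by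
  induction n with
  | zero => exact fun {F x y} h _ => ⟨fun _ => x, fun _ => y, rfl, rfl, fun i => i.elim0,
      fun i => i.elim0, h⟩
  | succ n ih =>
    intro F x y h hF
    obtain ⟨x', y', hx, hy, h'⟩ := h.exists_mapSyz1 (hF 0)
    obtain ⟨X, Y, hX0, hY0, hX, hY, hl⟩ := ih (F := fun i => F i.succ) h' fun i => hF i.succ
    refine ⟨Fin.cons x X, Fin.cons y Y, rfl, rfl, Fin.cases ?_ hX, Fin.cases ?_ hY, hl⟩
    · subst hX0
      exact hx
    · subst hY0
      exact hy

end Syzygy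

theorem statement14 (R : Type) [CommRing R] [IsNoetherianRing R] [IsLocalRing R]
    [IsAdicComplete (IsLocalRing.maximalIdeal R) R]
    (A B C : Mdl R) (hA : IsGP A) (hB : IsGP B) (hC : IsGP C)
    (fm : A.carrier →ₗ[R] B.carrier) (gm : B.carrier →ₗ[R] C.carrier)
    (hmono : Function.Injective fm) (hepi : Function.Surjective gm)
    (hex : LinearMap.range fm = LinearMap.ker gm)
    (hInd : MIndec (⟨A, B, fm⟩ : MObj R)) (hNP : ¬ MProj (⟨A, B, fm⟩ : MObj R))
    (n : ℕ) :
    ∀ s : MObj R, MSyz n (⟨A, B, fm⟩ : MObj R) s →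
      (∃ x : MObj R, MapSyz n (⟨A, B, fm⟩ : MObj R) x ∧ IsRedGCover s x) ∧
      (∃ y : MObj R, MapSyz n (⟨B, C, gm⟩ : MObj R) y ∧ IsRedEEnvelope (CokObj s) y) := by
  rintro s ⟨F, hF0, hFn, hF⟩
  have hexact : Exact fm gm := fun b => by rw [← mem_ker, ← hex]; rfl
  have h0 : IsReducedSeq (⟨A, B, fm⟩ : MObj R) gm :=
    { inj := hmono
      surj := hepi
      exact := hexact
      gp_dom := hA
      gp_cod := hB
      gp_cok := hC
      stable_dom := hInd.isStable_dom hNP hmono hepi hexact hC.extVanishes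
      stable_cok := hInd.isStable_cok hNP hepi hexact }
  have hT : IsReducedTriple (⟨A, B, fm⟩ : MObj R) ⟨A, B, fm⟩ ⟨B, C, gm⟩ :=
    ⟨C, gm, h0, EnlargesCod.refl _, EnlargesDom.refl _⟩
  obtain ⟨X, Y, hX0, hY0, hX, hY, hl⟩ := (hT.of_iso hF0.symm).exists_chain hF
  obtain ⟨C', c, hs, hx, hy⟩ := hl.of_iso hFn
  exact ⟨⟨_, ⟨X, hX0 ▸ MIso.refl _, MIso.refl _, hX⟩, hs.isRedGCover hx⟩,
    ⟨_, ⟨Y, hY0 ▸ MIso.refl _, MIso.refl _, hY⟩,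
      hs.cokObj.isRedEEnvelope (hs.enlargesDom_cokObj hy)⟩⟩
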